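/- arXiv:2306.05361 — 3 statements merged into one kernel-verified Lean document; each statement's English description precedes it below -/
import Mathlib

section
/- Let k be an algebraically closed field and let R be a regular local ring with maximal ideal 𝔪_R and residue field k, which is complete with respect to the 𝔪_R-adic topology. Let m ≥ 1 be an integer and let x ∈ 𝔪_R^m be an element with x ∉ 𝔪_R^{m+1}. Then there exists a surjective ring homomorphism R → R' onto a complete regular local ring R' of Krull dimension 1 such that the image of x in R' lies in 𝔪_{R'}^m but not in 𝔪_{R'}^{m+1}. -/
/-- A (Noetherian) local ring is regular if its maximal ideal is generated by
`dim R` elements, where `dim R` is the Krull dimension. -/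
def IsRegularLocal (R : Type*) [CommRing R] [IsLocalRing R] : Prop :=
  IsNoetherianRing R ∧
    ∃ s : Finset R, Ideal.span (s : Set R) = IsLocalRing.maximalIdeal R ∧
      (s.card : WithBot ℕ∞) = ringKrullDim R

open IsLocalRing

/-- A linear quotient of an adically precomplete module is precomplete. -/
theorem isPrecomplete_of_surjective {R M N : Type*} [CommRing R] [AddCommGroup M] [Module R M]
    [AddCommGroup N] [Module R N] (J : Ideal R) [IsPrecomplete J M] (f : M →ₗ[R] N)
    (hf : Function.Surjective f) : IsPrecomplete J N := by
  rw [← AdicCompletion.of_surjective_iff]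
  intro y
  obtain ⟨z, rfl⟩ := AdicCompletion.map_surjective J hf y
  obtain ⟨w, rfl⟩ := AdicCompletion.of_surjective J M z
  exact ⟨f w, (AdicCompletion.map_of J f w).symm⟩

theorem MvPolynomial.IsHomogeneous.eval₂_mul_const {σ R S : Type*} [CommSemiring R]
    [CommSemiring S] {φ : MvPolynomial σ R} {n : ℕ} (hφ : φ.IsHomogeneous n) (f : R →+* S)
    (c : σ → S) (s : S) :
    φ.eval₂ f (fun j => c j * s) = φ.eval₂ f c * s ^ n := by
  rw [MvPolynomial.eval₂_eq, MvPolynomial.eval₂_eq, Finset.sum_mul]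
  refine Finset.sum_congr rfl fun d hd => ?_
  have hdeg : ∑ i ∈ d.support, d i = n := (hφ.degree_eq_sum_deg_support hd).symm
  rw [← hdeg, ← Finset.prod_pow_eq_pow_sum, mul_assoc, ← Finset.prod_mul_distrib]
  simp only [mul_pow]

/-- A form of degree `n` evaluated at elements generating `J`, with coefficients in `J`,
lies in `J ^ (n + 1)`. -/
theorem MvPolynomial.IsHomogeneous.eval_mem_pow_succ {σ R : Type*} [CommRing R]
    {φ : MvPolynomial σ R} {n : ℕ} (hφ : φ.IsHomogeneous n) {J : Ideal R} {t : σ → R}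
    (ht : ∀ i, t i ∈ J) (hc : ∀ d, φ.coeff d ∈ J) : φ.eval t ∈ J ^ (n + 1) := by
  rw [MvPolynomial.eval_eq]
  refine Ideal.sum_mem _ fun d hd => ?_
  have hdeg : ∑ i ∈ d.support, d i = n := (hφ.degree_eq_sum_deg_support hd).symm
  rw [pow_succ', ← hdeg, ← Finset.prod_pow_eq_pow_sum]
  exact Ideal.mul_mem_mul (hc d) (Ideal.prod_mem_prod fun i _ => Ideal.pow_mem_pow (ht i) _)

/-- In a Noetherian local ring of nonzero dimension with principal maximal ideal `(s)`, one has
`s ^ n ∉ 𝔪 ^ (n + 1)`. -/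
theorem pow_notMem_maximalIdeal_pow_succ {R : Type*} [CommRing R] [IsLocalRing R]
    [IsNoetherianRing R] {s : R} (hs : maximalIdeal R = Ideal.span {s})
    (hdim : ringKrullDim R ≠ 0) (n : ℕ) : s ^ n ∉ maximalIdeal R ^ (n + 1) := by
  intro h
  rw [hs, Ideal.span_singleton_pow, Ideal.mem_span_singleton'] at h
  obtain ⟨c, hc⟩ := h
  have hu : IsUnit (1 - c * s) := by
    apply isUnit_one_sub_self_of_mem_nonunits
    rw [← mem_maximalIdeal, hs]
    exact Ideal.mul_mem_left _ _ (Ideal.mem_span_singleton_self s)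
  have h0 : s ^ n = 0 := by
    rw [← hu.mul_right_eq_zero]
    linear_combination -hc
  apply hdim
  rw [← ringKrullDimZero_iff_ringKrullDim_eq_zero, ← isArtinianRing_iff_krullDimLE_zero,
    isArtinianRing_iff_isNilpotent_maximalIdeal]
  exact ⟨n, by rw [hs, Ideal.span_singleton_pow, h0]; simp⟩

/-- A complete Noetherian local ring stays complete after passing to a local quotient. -/
theorem isAdicComplete_maximalIdeal_quotient {R : Type*} [CommRing R] [IsLocalRing R]
    [IsNoetherianRing R] [IsAdicComplete (maximalIdeal R) R] (I : Ideal R)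
    [IsLocalRing (R ⧸ I)] : IsAdicComplete (maximalIdeal (R ⧸ I)) (R ⧸ I) := by
  have hmap : (maximalIdeal R).map (algebraMap R (R ⧸ I)) = maximalIdeal (R ⧸ I) :=
    map_maximalIdeal_of_surjective _ Ideal.Quotient.mk_surjective
  have : IsPrecomplete (maximalIdeal (R ⧸ I)) (R ⧸ I) := by
    rw [← hmap, IsPrecomplete.map_algebraMap_iff]
    exact isPrecomplete_of_surjective _ (Submodule.mkQ I) (Submodule.mkQ_surjective I)
  exact { }

/-- Over a local ring with infinite residue field, a form of positive degree with a unit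
coefficient takes a unit value at some point with a unit coordinate. -/
theorem MvPolynomial.IsHomogeneous.exists_isUnit_eval {σ R : Type*} [CommRing R] [IsLocalRing R]
    [Infinite (ResidueField R)] {φ : MvPolynomial σ R} {n : ℕ} (hφ : φ.IsHomogeneous n)
    (hn : n ≠ 0) {d : σ →₀ ℕ} (hd : IsUnit (φ.coeff d)) :
    ∃ a : σ → R, IsUnit (φ.eval a) ∧ ∃ i, IsUnit (a i) := by
  have hne : MvPolynomial.map (residue R) φ ≠ 0 := fun h => by
    have := congrArg (MvPolynomial.coeff d) h
    rw [MvPolynomial.coeff_map, MvPolynomial.coeff_zero, residue_eq_zero_iff] at this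
    exact this hd
  obtain ⟨b, hb⟩ : ∃ b, (MvPolynomial.map (residue R) φ).eval b ≠ 0 := by
    by_contra! h
    exact hne (MvPolynomial.funext fun b => by simp [h b])
  choose a ha using fun i => residue_surjective (b i)
  obtain rfl : (fun i => residue R (a i)) = b := _root_.funext ha
  refine ⟨a, ?_, ?_⟩
  · rw [MvPolynomial.eval_map] at hb
    change MvPolynomial.eval₂ _ (residue R ∘ a) φ ≠ 0 at hb
    rw [← MvPolynomial.eval₂_comp] at hb
    exact (residue_ne_zero_iff_isUnit _).1 hb
  · by_contra! h
    have h0 : ∀ i, residue R (a i) = 0 := fun i => (residue_eq_zero_iff _).2 (h i)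
    apply hb
    simp only [h0]
    have := (hφ.map (residue R)).eval₂_mul_const (RingHom.id _) (fun _ => 0) 0
    simpa [hn, MvPolynomial.eval₂_id] using this

/-- Let `k` be an algebraically closed field and `R` a complete regular local ring
with residue field `k`.  If `x ∈ 𝔪_R^m \ 𝔪_R^(m+1)` for some `m ≥ 1`, then there is
an ideal `I ⊆ R` such that `R/I` is a complete regular local ring of Krull
dimension `1` and the image of `x` in `R/I` lies in `𝔪^m` but not in `𝔪^(m+1)`. -/
theorem exists_surjection_to_dim_one_regular_local
    (k : Type*) [Field k] [IsAlgClosed k]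
    (R : Type*) [CommRing R] [IsLocalRing R] [IsNoetherianRing R]
    [IsAdicComplete (IsLocalRing.maximalIdeal R) R]
    (hreg : IsRegularLocal R)
    (e : IsLocalRing.ResidueField R ≃+* k)
    (m : ℕ) (hm : 1 ≤ m) (x : R)
    (hx : x ∈ IsLocalRing.maximalIdeal R ^ m)
    (hx' : x ∉ IsLocalRing.maximalIdeal R ^ (m + 1)) :
    ∃ (I : Ideal R) (hloc : IsLocalRing (R ⧸ I)),
      @IsRegularLocal (R ⧸ I) _ hloc ∧
      IsAdicComplete (@IsLocalRing.maximalIdeal (R ⧸ I) _ hloc) (R ⧸ I) ∧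
      ringKrullDim (R ⧸ I) = 1 ∧
      Ideal.Quotient.mk I x ∈ (@IsLocalRing.maximalIdeal (R ⧸ I) _ hloc) ^ m ∧
      Ideal.Quotient.mk I x ∉ (@IsLocalRing.maximalIdeal (R ⧸ I) _ hloc) ^ (m + 1) := by
  obtain ⟨-, s, hs, hcard⟩ := hreg
  have hinf : Infinite (ResidueField R) := Infinite.of_surjective e e.surjective
  have hts : ∀ j : s, (j : R) ∈ maximalIdeal R := fun j => hs ▸ Ideal.subset_span j.2
  have hrange : Ideal.span (Set.range ((↑) : s → R)) = maximalIdeal R := by simpa using hs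
  have hxs := hx
  rw [← hrange, Ideal.mem_span_pow_iff_exists_isHomogeneous] at hxs
  obtain ⟨φ, hφ, hφx⟩ := hxs
  obtain ⟨d, hd⟩ : ∃ d, IsUnit (φ.coeff d) := by
    by_contra! h
    exact hx' (hφx ▸ hφ.eval_mem_pow_succ hts h)
  obtain ⟨a, ha, i, u, hu⟩ := hφ.exists_isUnit_eval (by lia) hd
  classical
  let T : Finset R := (Finset.univ.erase i).image fun j : s => (j : R) - a j * (↑u⁻¹ * i)
  have hT : (T : Set R) ⊆ maximalIdeal R := by
    intro y hy
    obtain ⟨j, -, rfl⟩ := Finset.mem_image.1 (Finset.mem_coe.1 hy)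
    exact sub_mem (hts j) (Ideal.mul_mem_left _ _ (Ideal.mul_mem_left _ _ (hts i)))
  have hTcard : T.card + 1 ≤ s.card := by
    have h1 : T.card ≤ (Finset.univ.erase i).card := Finset.card_image_le
    have h2 := Finset.card_erase_add_one (Finset.mem_univ i)
    rw [Finset.card_univ, Fintype.card_coe] at h2
    lia
  let I : Ideal R := Ideal.span T
  have hI : I ≠ ⊤ := ne_top_of_le_ne_top Ideal.IsPrime.ne_top' (Ideal.span_le.2 hT)
  have : Nontrivial (R ⧸ I) := Ideal.Quotient.nontrivial_iff.2 hI
  have hloc : IsLocalRing (R ⧸ I) :=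
    .of_surjective' (Ideal.Quotient.mk I) Ideal.Quotient.mk_surjective
  let π : R ⧸ I := Ideal.Quotient.mk I (↑u⁻¹ * i)
  have hmk : ∀ j : s, Ideal.Quotient.mk I j = Ideal.Quotient.mk I (a j) * π := by
    intro j
    rw [← map_mul]
    by_cases hj : j = i
    · subst hj
      rw [← hu, Units.mul_inv_cancel_left]
    · exact Ideal.Quotient.eq.2 (Ideal.subset_span (Finset.mem_coe.2
        (Finset.mem_image_of_mem _ (Finset.mem_erase.2 ⟨hj, Finset.mem_univ j⟩))))
  have hmap : (maximalIdeal R).map (Ideal.Quotient.mk I) = maximalIdeal (R ⧸ I) :=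
    map_maximalIdeal_of_surjective _ Ideal.Quotient.mk_surjective
  have hπ : maximalIdeal (R ⧸ I) = Ideal.span {π} := by
    apply le_antisymm
    · rw [← hmap, ← hs, Ideal.map_span, Ideal.span_le]
      rintro _ ⟨y, hy, rfl⟩
      exact Ideal.mem_span_singleton'.2 ⟨_, (hmk ⟨y, hy⟩).symm⟩
    · rw [Ideal.span_singleton_le_iff_mem, ← hmap]
      exact Ideal.mem_map_of_mem _ (Ideal.mul_mem_left _ _ (hts i))
  have hle : ringKrullDim (R ⧸ I) ≤ 1 := by
    refine (ringKrullDim_le_spanFinrank_maximalIdeal _).trans ?_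
    rw [hπ, Nat.cast_le_one]
    simpa using Submodule.spanFinrank_span_le_ncard_of_finite (R := R ⧸ I)
      (Set.finite_singleton π)
  have hge : ringKrullDim R ≤ ringKrullDim (R ⧸ I) + T.card :=
    ringKrullDim_le_ringKrullDim_quotient_add_card T
      (by rwa [ringJacobson_eq_maximalIdeal])
  have hdim : ringKrullDim (R ⧸ I) = 1 := by
    refine le_antisymm hle (not_lt.1 fun hlt => ?_)
    have h0 : ringKrullDim (R ⧸ I) ≤ 0 := by
      rwa [← zero_add (1 : WithBot ℕ∞), ← Nat.cast_zero, ENat.WithBot.lt_add_one_iff] at hlt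
    have h1 : (s.card : WithBot ℕ∞) ≤ T.card := by
      rw [hcard]
      exact hge.trans (by simpa using add_le_add_left h0 (T.card : WithBot ℕ∞))
    have h2 : s.card ≤ T.card := by exact_mod_cast h1
    lia
  have hxπ : Ideal.Quotient.mk I x = Ideal.Quotient.mk I (φ.eval a) * π ^ m := by
    rw [← hφx, MvPolynomial.eval₂_comp, MvPolynomial.eval₂_comp,
      ← hφ.eval₂_mul_const]
    exact congrArg (fun g => φ.eval₂ _ g) (funext hmk)
  refine ⟨I, hloc, ⟨inferInstance, {π}, by simp [hπ], by simp [hdim]⟩,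
    isAdicComplete_maximalIdeal_quotient I, hdim, ?_, ?_⟩
  · rw [← hmap, ← Ideal.map_pow]
    exact Ideal.mem_map_of_mem _ hx
  · rw [hxπ, Ideal.unit_mul_mem_iff_mem _ (ha.map _)]
    exact pow_notMem_maximalIdeal_pow_succ hπ (by simp [hdim]) m
end

section
/- Let R be a regular local ring of Krull dimension n ≥ 2 whose residue field is infinite. Let m ≥ 1 be an integer and let x ∈ 𝔪_R^m be an element with x ∉ 𝔪_R^{m+1}. Then there exists an element r ∈ 𝔪_R with r ∉ 𝔪_R^2 such that the quotient R' := R/(r) is a regular local ring of Krull dimension n − 1 and the image of x in R' lies in 𝔪_{R'}^m but not in 𝔪_{R'}^{m+1}. -/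
open IsLocalRing

section

universe u

/-- A product of elements, each of which can be cancelled modulo `I` at the cost of one power of
the ideal `J`, can itself be cancelled. -/
lemma Ideal.mem_sup_pow_of_prod_mul_mem {R : Type*} [CommRing R] {I J : Ideal R} {s : ℕ → R}
    (k : ℕ) (hs : ∀ j < k, ∀ l a, s j * a ∈ I ⊔ J ^ (l + 1) → a ∈ I ⊔ J ^ l)
    {l : ℕ} {y : R} (hy : (∏ j ∈ Finset.range k, s j) * y ∈ I ⊔ J ^ (l + k)) :
    y ∈ I ⊔ J ^ l := by
  induction k generalizing y l with
  | zero => simpa using hy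
  | succ k ih =>
    refine hs k k.lt_succ_self _ _ (ih (fun j hj => hs j (hj.trans k.lt_succ_self)) ?_)
    rwa [Finset.prod_range_succ, mul_assoc, show l + (k + 1) = l + 1 + k by ring] at hy

/-- An element of `J ^ m` which lies in `(s i) + J ^ (m + 1)` for sufficiently many independent
`s i` lies in `J ^ (m + 1)`. -/
lemma Ideal.mem_pow_succ_of_forall_mem_span_sup {R : Type*} [CommRing R] {J : Ideal R} {s : ℕ → R}
    {m : ℕ} (hsJ : ∀ i, s i ∈ J)
    (hcancel : ∀ i, ∀ l < m, ∀ a, s i * a ∈ J ^ (l + 1) → a ∈ J ^ l)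
    (hcancel_mod : ∀ i j, i ≠ j → ∀ l a,
      s j * a ∈ Ideal.span {s i} ⊔ J ^ (l + 1) → a ∈ Ideal.span {s i} ⊔ J ^ l)
    {x : R} (hx : x ∈ J ^ m) (hmem : ∀ i, x ∈ Ideal.span {s i} ⊔ J ^ (m + 1)) :
    x ∈ J ^ (m + 1) := by
  have prod_mem (k : ℕ) : ∏ j ∈ Finset.range k, s j ∈ J ^ k := by
    simpa using Ideal.prod_mem_prod (s := Finset.range k) (I := fun _ => J) fun j _ => hsJ j
  have peel {k l : ℕ} {y : R} (hkl : l + k = m + 1)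
      (hxy : x - (∏ j ∈ Finset.range k, s j) * y ∈ J ^ (m + 1)) :
      y ∈ Ideal.span {s k} ⊔ J ^ l := by
    refine Ideal.mem_sup_pow_of_prod_mul_mem k (fun j hj => hcancel_mod k j hj.ne') ?_
    rw [hkl]
    simpa using sub_mem (hmem k) (Ideal.mem_sup_right hxy)
  have factor (k : ℕ) : ∀ l, l + k = m →
      ∃ y ∈ J ^ l, x - (∏ j ∈ Finset.range k, s j) * y ∈ J ^ (m + 1) := by
    induction k with
    | zero =>
      rintro l rfl
      exact ⟨x, hx, by simp⟩
    | succ k ih =>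
      intro l hl
      obtain ⟨y, hy, hxy⟩ := ih (l + 1) (by omega)
      obtain ⟨c, z, hz, rfl⟩ :=
        Ideal.mem_span_singleton_sup.mp (peel (l := l + 2) (by omega) hxy)
      refine ⟨c, hcancel k l (by omega) c ?_, ?_⟩
      · have := sub_mem hy (Ideal.pow_le_pow_right (Nat.le_succ (l + 1)) hz)
        rwa [add_sub_cancel_right, mul_comm] at this
      · have hPz := Ideal.mul_mem_mul (prod_mem k) hz
        rw [← pow_add, show k + (l + 2) = m + 1 by omega] at hPz
        convert! add_mem hxy hPz using 1
        rw [Finset.prod_range_succ]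
        ring
  obtain ⟨y, -, hxy⟩ := factor m 0 (by omega)
  have hy := peel (l := 1) (by omega) hxy
  rw [pow_one, sup_eq_right.mpr ((Ideal.span_singleton_le_iff_mem _).mpr (hsJ m))] at hy
  have hPy := Ideal.mul_mem_mul (prod_mem m) hy
  rw [← pow_succ] at hPy
  simpa using add_mem hxy hPy

namespace IsLocalRing

variable {R : Type u} [CommRing R] [IsLocalRing R]

/-- In a generating set of the maximal ideal, some element can be exchanged for a given
`r ∈ 𝔪 \ 𝔪 ^ 2`. -/
lemma exists_card_lt_span_sup_eq_maximalIdeal {s : Finset R}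
    (hs : Ideal.span (s : Set R) = maximalIdeal R) {r : R} (hr : r ∈ maximalIdeal R)
    (hr' : r ∉ maximalIdeal R ^ 2) :
    ∃ t : Finset R, t.card < s.card ∧
      Ideal.span (t : Set R) ⊔ Ideal.span {r} = maximalIdeal R := by
  classical
  have hsub : ∀ i ∈ s, i ∈ maximalIdeal R := fun i hi => hs ▸ Ideal.subset_span hi
  obtain ⟨c, -, hc⟩ := Submodule.mem_span_finset.mp (hs ▸ hr : r ∈ Ideal.span (s : Set R))
  obtain ⟨i, hi, hci⟩ : ∃ i ∈ s, IsUnit (c i) := by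
    by_contra! h
    refine hr' (hc ▸ sum_mem fun i hi => ?_)
    rw [pow_two]
    exact Ideal.mul_mem_mul ((mem_maximalIdeal _).mpr (h i hi)) (hsub i hi)
  refine ⟨s.erase i, Finset.card_erase_lt_of_mem hi, le_antisymm ?_ ?_⟩
  · refine sup_le (hs ▸ Ideal.span_mono (by simp)) ((Ideal.span_singleton_le_iff_mem _).mpr hr)
  · rw [← hs, Ideal.span_le]
    intro j hj
    by_cases hij : j = i
    · subst hij
      refine (Ideal.unit_mul_mem_iff_mem _ hci).mp ?_
      rw [← Finset.add_sum_erase _ _ hi] at hc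
      rw [← smul_eq_mul, eq_sub_of_add_eq hc]
      refine sub_mem (Ideal.mem_sup_right (Ideal.mem_span_singleton_self r))
        (Ideal.mem_sup_left (sum_mem fun a ha => ?_))
      exact Ideal.mul_mem_left _ _ (Ideal.subset_span ha)
    · exact Ideal.mem_sup_left (Ideal.subset_span (by simp [hij, Finset.mem_coe.mp hj]))

lemma maximalIdeal_eq_span_singleton_of_forall_mem [IsNoetherianRing R] {r : R}
    (hr : r ∈ maximalIdeal R)
    (h : ∀ t ∈ maximalIdeal R, t ∈ Ideal.span {r} ⊔ maximalIdeal R ^ 2) :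
    maximalIdeal R = Ideal.span {r} := by
  refine le_antisymm ?_ ((Ideal.span_singleton_le_iff_mem _).mpr hr)
  refine Submodule.le_of_le_smul_of_le_jacobson_bot (I := maximalIdeal R)
    (IsNoetherian.noetherian _) (maximalIdeal_le_jacobson _) fun t ht => ?_
  rw [smul_eq_mul, ← pow_two]
  exact h t ht

section Pencil

variable {r t : R}

/-- Elements of `𝔪` that are independent modulo `𝔪 ^ 2` admit only relations with coefficients
in `𝔪`. -/
lemma mem_maximalIdeal_of_mul_add_mul_mem_sq (ht : t ∈ maximalIdeal R)
    (hr' : r ∉ maximalIdeal R ^ 2)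
    (ht' : t ∉ Ideal.span {r} ⊔ maximalIdeal R ^ 2) {α β : R}
    (h : α * r + β * t ∈ maximalIdeal R ^ 2) :
    α ∈ maximalIdeal R ∧ β ∈ maximalIdeal R := by
  have hβ : β ∈ maximalIdeal R := by
    by_contra hβ
    refine ht' ((Ideal.unit_mul_mem_iff_mem _ (notMem_maximalIdeal.mp hβ)).mp ?_)
    exact Ideal.mem_span_singleton_sup.mpr ⟨-α, _, h, by ring⟩
  refine ⟨?_, hβ⟩
  by_contra hα
  refine hr' ((Ideal.unit_mul_mem_iff_mem _ (notMem_maximalIdeal.mp hα)).mp ?_)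
  have hβt := Ideal.mul_mem_mul hβ ht
  rw [← pow_two] at hβt
  simpa using sub_mem h hβt

lemma notMem_span_add_mul_sup_sq (ht : t ∈ maximalIdeal R)
    (hr' : r ∉ maximalIdeal R ^ 2)
    (ht' : t ∉ Ideal.span {r} ⊔ maximalIdeal R ^ 2) {b c : R} (hbc : IsUnit (b - c)) :
    r + b * t ∉ Ideal.span {r + c * t} ⊔ maximalIdeal R ^ 2 := by
  intro h
  obtain ⟨d, q, hq, hdq⟩ := Ideal.mem_span_singleton_sup.mp h
  have hrel : (1 - d) * r + (b - d * c) * t ∈ maximalIdeal R ^ 2 := by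
    convert! hq using 1
    linear_combination -hdq
  obtain ⟨h₁, h₂⟩ := mem_maximalIdeal_of_mul_add_mul_mem_sq ht hr' ht' hrel
  refine (mem_maximalIdeal _).mp ?_ hbc
  convert! sub_mem h₂ (Ideal.mul_mem_left _ c h₁) using 1
  ring

/-- The elements `r + b i * t` of a pencil are pairwise independent modulo `𝔪 ^ 2`, and
independent of `r`. -/
lemma exists_seq_notMem_span_sup_sq (hr : r ∈ maximalIdeal R) (ht : t ∈ maximalIdeal R)
    (hr' : r ∉ maximalIdeal R ^ 2) (ht' : t ∉ Ideal.span {r} ⊔ maximalIdeal R ^ 2)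
    {b : ℕ → R} (hb : ∀ i, IsUnit (b i)) (hbb : ∀ i j, i ≠ j → IsUnit (b i - b j)) :
    ∃ s : ℕ → R, (∀ i, s i ∈ maximalIdeal R) ∧ (∀ i, s i ∉ maximalIdeal R ^ 2) ∧
      (∀ i, r ∉ Ideal.span {s i} ⊔ maximalIdeal R ^ 2) ∧
      ∀ i j, i ≠ j → s j ∉ Ideal.span {s i} ⊔ maximalIdeal R ^ 2 := by
  have hss (i j : ℕ) (hij : i ≠ j) :
      r + b j * t ∉ Ideal.span {r + b i * t} ⊔ maximalIdeal R ^ 2 :=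
    notMem_span_add_mul_sup_sq ht hr' ht' (hbb j i hij.symm)
  refine ⟨fun i => r + b i * t, fun i => add_mem hr (Ideal.mul_mem_left _ _ ht),
    fun i h => hss (i + 1) i (by omega) (Ideal.mem_sup_right h), fun i => ?_, hss⟩
  simpa using notMem_span_add_mul_sup_sq ht hr' ht' (b := 0) (by simpa using (hb i).neg)

end Pencil

/-- If `𝔪 = (r)` and `r` is not nilpotent, multiplication by `r` shifts the `𝔪`-adic filtration
strictly. -/
lemma mem_pow_of_mul_mem_of_maximalIdeal_eq_span [IsNoetherianRing R] {r : R}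
    (hspan : maximalIdeal R = Ideal.span {r}) (hr : ¬ IsNilpotent r) {k : ℕ} {a : R}
    (h : r * a ∈ maximalIdeal R ^ (k + 1)) : a ∈ maximalIdeal R ^ k := by
  have hreg {d : R} (hd : r * d = 0) : d = 0 := by
    have hpow (j : ℕ) : d ∈ maximalIdeal R ^ j := by
      induction j with
      | zero => simp
      | succ j ih =>
        rw [hspan, Ideal.span_singleton_pow, Ideal.mem_span_singleton'] at ih ⊢
        obtain ⟨e, rfl⟩ := ih
        by_cases he : e ∈ maximalIdeal R
        · rw [hspan, Ideal.mem_span_singleton'] at he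
          obtain ⟨f, rfl⟩ := he
          exact ⟨f, by ring⟩
        · refine absurd ⟨j + 1, ?_⟩ hr
          refine (notMem_maximalIdeal.mp he).mul_right_eq_zero.mp ?_
          rw [← hd]
          ring
    have := Ideal.iInf_pow_eq_bot_of_isLocalRing (maximalIdeal R) Ideal.IsPrime.ne_top'
    rw [← Ideal.mem_bot, ← this]
    exact Ideal.mem_iInf.mpr hpow
  rw [hspan, Ideal.span_singleton_pow, Ideal.mem_span_singleton'] at h ⊢
  obtain ⟨c, hc⟩ := h
  refine ⟨c, sub_eq_zero.mp (hreg ?_)⟩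
  linear_combination hc

lemma mk_mem_maximalIdeal_pow_iff {I : Ideal R} [IsLocalRing (R ⧸ I)] {x : R} {k : ℕ} :
    Ideal.Quotient.mk I x ∈ maximalIdeal (R ⧸ I) ^ k ↔ x ∈ I ⊔ maximalIdeal R ^ k := by
  rw [← map_maximalIdeal_of_surjective _ Ideal.Quotient.mk_surjective, ← Ideal.map_pow,
    Ideal.mem_quotient_iff_mem_sup, sup_comm]

lemma mem_sup_pow_of_mul_mem_of_quotient {I : Ideal R} [IsLocalRing (R ⧸ I)]
    (h : ∀ q ∈ maximalIdeal (R ⧸ I), q ∉ maximalIdeal (R ⧸ I) ^ 2 → ∀ (l : ℕ) (c : R ⧸ I),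
      q * c ∈ maximalIdeal (R ⧸ I) ^ (l + 1) → c ∈ maximalIdeal (R ⧸ I) ^ l)
    {q : R} (hq : q ∈ maximalIdeal R) (hq' : q ∉ I ⊔ maximalIdeal R ^ 2) {l : ℕ} {c : R}
    (hc : q * c ∈ I ⊔ maximalIdeal R ^ (l + 1)) : c ∈ I ⊔ maximalIdeal R ^ l := by
  rw [← mk_mem_maximalIdeal_pow_iff] at hq' hc ⊢
  refine h _ ?_ hq' l _ (by rwa [← map_mul])
  rw [← pow_one (maximalIdeal _), mk_mem_maximalIdeal_pow_iff, pow_one]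
  exact Ideal.mem_sup_right hq

end IsLocalRing

namespace IsRegularLocalRing

variable {R : Type u} [CommRing R] [IsRegularLocalRing R]

lemma ringKrullDim_ne_zero_of_notMem_sq {r : R} (hr : r ∈ maximalIdeal R)
    (hr' : r ∉ maximalIdeal R ^ 2) : ringKrullDim R ≠ 0 := by
  intro h
  have h₀ : (maximalIdeal R).spanFinrank = 0 := by
    exact_mod_cast (spanFinrank_maximalIdeal (R := R)).trans h
  have hbot := (Submodule.spanFinrank_eq_zero_iff_eq_bot (IsNoetherian.noetherian _)).mp h₀
  rw [hbot, Ideal.mem_bot] at hr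
  exact hr' (hr ▸ zero_mem _)

/-- The quotient of a regular local ring by an element of `𝔪 \ 𝔪 ^ 2` is regular, of dimension
one less. -/
lemma quotient_span_singleton {r : R} (hr : r ∈ maximalIdeal R)
    (hr' : r ∉ maximalIdeal R ^ 2) {n : ℕ} (hn : ringKrullDim R = (n + 1 : ℕ)) :
    IsRegularLocalRing (R ⧸ Ideal.span {r}) ∧ ringKrullDim (R ⧸ Ideal.span {r}) = n := by
  classical
  have hle : Ideal.span {r} ≤ maximalIdeal R := (Ideal.span_singleton_le_iff_mem _).mpr hr
  have : Nontrivial (R ⧸ Ideal.span {r}) :=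
    Ideal.Quotient.nontrivial_iff.mpr (ne_top_of_le_ne_top Ideal.IsPrime.ne_top' hle)
  have : IsLocalRing (R ⧸ Ideal.span {r}) :=
    .of_surjective' (Ideal.Quotient.mk _) Ideal.Quotient.mk_surjective
  obtain ⟨s, hcard, hs⟩ := Submodule.FG.exists_span_finset_card_eq_spanFinrank
    (IsNoetherian.noetherian (maximalIdeal R))
  have hcard' : s.card = n + 1 := by
    rw [hcard]
    exact_mod_cast (spanFinrank_maximalIdeal (R := R)).trans hn
  obtain ⟨t, ht, hspan⟩ := exists_card_lt_span_sup_eq_maximalIdeal hs hr hr'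
  have hmap : maximalIdeal (R ⧸ Ideal.span {r}) =
      Ideal.span (t.image (Ideal.Quotient.mk (Ideal.span {r})) : Set (R ⧸ Ideal.span {r})) := by
    rw [← map_maximalIdeal_of_surjective _ Ideal.Quotient.mk_surjective, ← hspan, Ideal.map_sup,
      Ideal.map_quotient_self, sup_bot_eq, Ideal.map_span, Finset.coe_image]
  have hrank : (maximalIdeal (R ⧸ Ideal.span {r})).spanFinrank ≤ n := by
    rw [hmap]
    refine (Submodule.spanFinrank_span_le_ncard_of_finite (Finset.finite_toSet _)).trans ?_
    rw [Set.ncard_coe_finset]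
    exact Finset.card_image_le.trans (by omega)
  have hlower : (n : WithBot ℕ∞) ≤ ringKrullDim (R ⧸ Ideal.span {r}) := by
    have h := ringKrullDim_le_ringKrullDim_quotient_add_card {r} (R := R)
      (by simpa using ringJacobson_eq_maximalIdeal R ▸ hr)
    rw [hn, Finset.coe_singleton, Finset.card_singleton, Nat.cast_add] at h
    exact (ENat.WithBot.add_le_add_natCast_right_iff (c := 1)).mp h
  have hrank' : ((maximalIdeal (R ⧸ Ideal.span {r})).spanFinrank : WithBot ℕ∞) ≤ n := by
    exact_mod_cast hrank
  exact ⟨.of_spanFinrank_maximalIdeal_le _ (hrank'.trans hlower),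
    le_antisymm ((ringKrullDim_le_spanFinrank_maximalIdeal _).trans hrank') hlower⟩

/-- In a regular local ring, multiplication by an element of `𝔪 \ 𝔪 ^ 2` raises the order by
exactly one. The sequence `b` expresses that the residue field is infinite. -/
theorem mem_pow_of_mul_mem {n : ℕ} (hn : ringKrullDim R = n) {b : ℕ → R}
    (hb : ∀ i, IsUnit (b i)) (hbb : ∀ i j, i ≠ j → IsUnit (b i - b j))
    {r : R} (hr : r ∈ maximalIdeal R) (hr' : r ∉ maximalIdeal R ^ 2) {k : ℕ} {a : R}
    (ha : r * a ∈ maximalIdeal R ^ (k + 1)) : a ∈ maximalIdeal R ^ k := by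
  induction n generalizing R k with
  | zero => exact absurd hn (ringKrullDim_ne_zero_of_notMem_sq hr hr')
  | succ n ihn =>
    induction k using Nat.strong_induction_on generalizing r a with | _ k ihk
    by_cases hdep : ∀ t ∈ maximalIdeal R, t ∈ Ideal.span {r} ⊔ maximalIdeal R ^ 2
    · have hspan := maximalIdeal_eq_span_singleton_of_forall_mem hr hdep
      refine mem_pow_of_mul_mem_of_maximalIdeal_eq_span hspan ?_ ha
      rintro ⟨j, hj⟩
      refine ringKrullDim_ne_zero_of_notMem_sq hr hr' ?_
      rw [← ringKrullDimZero_iff_ringKrullDim_eq_zero, ← isArtinianRing_iff_krullDimLE_zero,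
        isArtinianRing_iff_isNilpotent_maximalIdeal]
      exact ⟨j, by rw [hspan, Ideal.span_singleton_pow, hj]; simp⟩
    · push Not at hdep
      obtain ⟨t, ht, ht'⟩ := hdep
      obtain ⟨s, hs, hs', hrs, hss⟩ := exists_seq_notMem_span_sup_sq hr ht hr' ht' hb hbb
      have hmod (i : ℕ) {q : R} (hq : q ∈ maximalIdeal R)
          (hq' : q ∉ Ideal.span {s i} ⊔ maximalIdeal R ^ 2) {l : ℕ} {c : R}
          (hc : q * c ∈ Ideal.span {s i} ⊔ maximalIdeal R ^ (l + 1)) :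
          c ∈ Ideal.span {s i} ⊔ maximalIdeal R ^ l := by
        obtain ⟨_, hdim⟩ := quotient_span_singleton (hs i) (hs' i) hn
        refine mem_sup_pow_of_mul_mem_of_quotient (fun q hq hq' l c hc => ?_) hq hq' hc
        refine ihn hdim (b := fun j => Ideal.Quotient.mk _ (b j)) (fun j => (hb j).map _)
          (fun i j hij => ?_) hq hq' hc
        rw [← map_sub]
        exact (hbb i j hij).map _
      rcases k with _ | k
      · simp
      refine Ideal.mem_pow_succ_of_forall_mem_span_sup hs
        (fun i l hl c => ihk l (by omega) (hs i) (hs' i))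
        (fun i j hij l c => hmod i (hs j) (hss i j hij)) ?_
        (fun i => hmod i hr (hrs i) (Ideal.mem_sup_right ha))
      exact ihk k k.lt_succ_self hr hr' (Ideal.pow_le_pow_right (Nat.le_succ _) ha)

end IsRegularLocalRing

lemma IsRegularLocal.isRegularLocalRing {R : Type u} [CommRing R] [IsLocalRing R]
    (h : IsRegularLocal R) : IsRegularLocalRing R := by
  obtain ⟨_, s, hs, hcard⟩ := h
  refine .of_spanFinrank_maximalIdeal_le _ ?_
  rw [← hcard, ← hs]
  have := Submodule.spanFinrank_span_le_ncard_of_finite (R := R) s.finite_toSet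
  rw [Set.ncard_coe_finset] at this
  exact_mod_cast this

lemma IsRegularLocalRing.isRegularLocal (R : Type u) [CommRing R] [IsRegularLocalRing R] :
    IsRegularLocal R := by
  obtain ⟨s, hcard, hs⟩ := Submodule.FG.exists_span_finset_card_eq_spanFinrank
    (IsNoetherian.noetherian (maximalIdeal R))
  exact ⟨inferInstance, s, hs, hcard ▸ IsRegularLocalRing.spanFinrank_maximalIdeal⟩

lemma IsLocalRing.exists_seq_isUnit_sub (R : Type u) [CommRing R] [IsLocalRing R]
    [Infinite (ResidueField R)] :
    ∃ b : ℕ → R, (∀ i, IsUnit (b i)) ∧ ∀ i j, i ≠ j → IsUnit (b i - b j) := by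
  let e := Infinite.natEmbedding (ResidueField R)
  choose c hc using fun i => residue_surjective (e i)
  have hcc (i j : ℕ) (hij : i ≠ j) : IsUnit (c i - c j) := by
    rw [← residue_ne_zero_iff_isUnit, map_sub, hc, hc, sub_ne_zero]
    exact e.injective.ne hij
  exact ⟨fun i => c (i + 1) - c 0, fun i => hcc _ _ (by omega),
    fun i j hij => by simpa using hcc (i + 1) (j + 1) (by omega)⟩

end

/-- Let `R` be a regular local ring of Krull dimension `n ≥ 2` with infinite residue
field, and let `x ∈ 𝔪_R^m \ 𝔪_R^(m+1)` for some `m ≥ 1`.  Then there exists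
`r ∈ 𝔪_R`, `r ∉ 𝔪_R^2`, such that `R/(r)` is a regular local ring of Krull
dimension `n - 1` and the image of `x` in `R/(r)` lies in `𝔪^m` but not in
`𝔪^(m+1)`. -/
theorem exists_regular_parameter_cut
    (R : Type*) [CommRing R] [IsLocalRing R]
    [Infinite (IsLocalRing.ResidueField R)]
    (n : ℕ) (hn : 2 ≤ n) (hdim : ringKrullDim R = (n : ℕ))
    (hreg : IsRegularLocal R)
    (m : ℕ) (hm : 1 ≤ m) (x : R)
    (hx : x ∈ IsLocalRing.maximalIdeal R ^ m)
    (hx' : x ∉ IsLocalRing.maximalIdeal R ^ (m + 1)) :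
    ∃ r ∈ IsLocalRing.maximalIdeal R, r ∉ IsLocalRing.maximalIdeal R ^ 2 ∧
      ∃ hloc : IsLocalRing (R ⧸ Ideal.span {r}),
        @IsRegularLocal (R ⧸ Ideal.span {r}) _ hloc ∧
        ringKrullDim (R ⧸ Ideal.span {r}) = ((n - 1 : ℕ) : WithBot ℕ∞) ∧
        Ideal.Quotient.mk (Ideal.span {r}) x ∈
          (@IsLocalRing.maximalIdeal (R ⧸ Ideal.span {r}) _ hloc) ^ m ∧
        Ideal.Quotient.mk (Ideal.span {r}) x ∉
          (@IsLocalRing.maximalIdeal (R ⧸ Ideal.span {r}) _ hloc) ^ (m + 1) := by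
  have := hreg.isRegularLocalRing
  obtain ⟨d, rfl⟩ : ∃ d, n = d + 1 := ⟨n - 1, by omega⟩
  obtain ⟨b, hb, hbb⟩ := exists_seq_isUnit_sub R
  obtain ⟨r, hr, hr'⟩ := SetLike.exists_of_lt
    (maximalIdeal_sq_lt_of_ringKrullDim_ne_zero (R := R) (by rw [hdim]; norm_cast))
  obtain ⟨t, ht, ht'⟩ :
      ∃ t ∈ maximalIdeal R, t ∉ Ideal.span {r} ⊔ maximalIdeal R ^ 2 := by
    by_contra! h
    have hspan := maximalIdeal_eq_span_singleton_of_forall_mem hr h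
    have hquot := (IsRegularLocalRing.quotient_span_singleton hr hr' hdim).2
    have hmax : (Ideal.span {r}).IsMaximal := hspan ▸ inferInstance
    rw [ringKrullDim_eq_zero_of_isField
      ((Ideal.Quotient.maximal_ideal_iff_isField_quotient _).mp hmax)] at hquot
    have : 0 = d := by exact_mod_cast hquot
    omega
  obtain ⟨s, hs, hs', -, hss⟩ := exists_seq_notMem_span_sup_sq hr ht hr' ht' hb hbb
  obtain ⟨i, hi⟩ : ∃ i, x ∉ Ideal.span {s i} ⊔ maximalIdeal R ^ (m + 1) := by
    by_contra! h
    refine hx' (Ideal.mem_pow_succ_of_forall_mem_span_sup hs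
      (fun i l _ c => IsRegularLocalRing.mem_pow_of_mul_mem hdim hb hbb (hs i) (hs' i))
      (fun i j hij l c => ?_) hx h)
    obtain ⟨_, hdim'⟩ := IsRegularLocalRing.quotient_span_singleton (hs i) (hs' i) hdim
    refine mem_sup_pow_of_mul_mem_of_quotient (fun q hq hq' l c hc => ?_) (hs j) (hss i j hij)
    refine IsRegularLocalRing.mem_pow_of_mul_mem hdim' (b := fun j => Ideal.Quotient.mk _ (b j))
      (fun j => (hb j).map _) (fun i j hij => ?_) hq hq' hc
    rw [← map_sub]
    exact (hbb i j hij).map _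
  obtain ⟨hreg', hdim'⟩ := IsRegularLocalRing.quotient_span_singleton (hs i) (hs' i) hdim
  exact ⟨s i, hs i, hs' i, inferInstance, IsRegularLocalRing.isRegularLocal _, hdim',
    mk_mem_maximalIdeal_pow_iff.mpr (Ideal.mem_sup_right hx),
    fun h => hi (mk_mem_maximalIdeal_pow_iff.mp h)⟩
end

section
/- Let p be a prime, let k be a perfect field of characteristic p with ring of p-typical Witt vectors W(k), and let R be a regular local ring, complete with respect to its maximal ideal 𝔪_R, equipped with a local ring homomorphism W(k) → R inducing an isomorphism on residue fields. Let m ≥ 1 be an integer and let x ∈ 𝔪_R^m with x ∉ 𝔪_R^{m+1}. Then there exist: an integral domain V which is a valuation ring of Krull dimension 1, p-adically complete, whose fraction field is algebraically closed, and which is a W(k)-algebra; a nonzero nonunit a ∈ V with p ∈ (a); and a W(k)-algebra homomorphism g : R → V/(a^{m+1}) such that g(𝔪_R) ⊆ (a)/(a^{m+1}) and g(x) ≠ 0 in V/(a^{m+1}). -/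
/-- The data promised by the conclusion: a `p`-adically complete rank-one valuation
ring `V` with algebraically closed fraction field, a `W(k)`-algebra structure
`φ : W(k) → V`, a nonzero nonunit `a ∈ V` with `p ∈ (a)`, and a `W(k)`-algebra
homomorphism `g : R → V/(a^(m+1))` carrying `𝔪_R` into `(a)` with `g x ≠ 0`. -/
structure ValuationRingWitness (p : ℕ) [Fact p.Prime] (k : Type) [CommRing k]
    (R : Type) [CommRing R] [IsLocalRing R]
    (ι : WittVector p k →+* R) (m : ℕ) (x : R) where
  V : Type
  [instCommRing : CommRing V]
  [instIsDomain : IsDomain V]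
  [instValuationRing : ValuationRing V]
  dim_one : ringKrullDim V = 1
  p_adically_complete : IsAdicComplete (Ideal.span {(p : V)}) V
  frac_alg_closed : IsAlgClosed (FractionRing V)
  φ : WittVector p k →+* V
  a : V
  a_ne_zero : a ≠ 0
  a_not_unit : ¬ IsUnit a
  p_mem_span_a : (p : V) ∈ Ideal.span {a}
  g : R →+* V ⧸ Ideal.span {a ^ (m + 1)}
  g_compat : g.comp ι = (Ideal.Quotient.mk (Ideal.span {a ^ (m + 1)})).comp φ
  g_maximalIdeal : ∀ y ∈ IsLocalRing.maximalIdeal R,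
    g y ∈ Ideal.span {Ideal.Quotient.mk (Ideal.span {a ^ (m + 1)}) a}
  g_x_ne_zero : g x ≠ 0

open IsLocalRing

theorem MvPolynomial.IsHomogeneous.eval₂_mul_left {R S σ : Type*} [CommSemiring R] [CommSemiring S]
    {F : MvPolynomial σ R} {n : ℕ} (hF : F.IsHomogeneous n) (f : R →+* S) (t : S) (z : σ → S) :
    F.eval₂ f (fun j => t * z j) = t ^ n * F.eval₂ f z := by
  rw [MvPolynomial.eval₂_eq, MvPolynomial.eval₂_eq, Finset.mul_sum]
  refine Finset.sum_congr rfl fun e he => ?_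
  have : ∑ j ∈ e.support, e j = n := by
    simpa [Finsupp.weight_apply, Finsupp.sum] using hF (MvPolynomial.mem_support_iff.mp he)
  simp only [mul_pow, Finset.prod_mul_distrib, Finset.prod_pow_eq_pow_sum, this]
  ring

/-- The extension of an ideal `P` to a polynomial ring: polynomials with coefficients in `P`. -/
noncomputable abbrev MvPolynomial.extendIdeal {R : Type*} (σ : Type*) [CommRing R] (P : Ideal R) :
    Ideal (MvPolynomial σ R) :=
  RingHom.ker (MvPolynomial.map (σ := σ) (Ideal.Quotient.mk P))

theorem MvPolynomial.mem_extendIdeal {R σ : Type*} [CommRing R] {P : Ideal R}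
    {F : MvPolynomial σ R} : F ∈ extendIdeal σ P ↔ ∀ e, F.coeff e ∈ P := by
  simp [extendIdeal, RingHom.mem_ker, MvPolynomial.ext_iff, MvPolynomial.coeff_map,
    Ideal.Quotient.eq_zero_iff_mem]

theorem MvPolynomial.C_mem_extendIdeal {R σ : Type*} [CommRing R] {P : Ideal R} {r : R} :
    C r ∈ extendIdeal σ P ↔ r ∈ P := by
  simp [extendIdeal, RingHom.mem_ker, Ideal.Quotient.eq_zero_iff_mem]

theorem MvPolynomial.height_le_height_extendIdeal {R : Type*} (σ : Type*) [CommRing R]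
    (P : Ideal R) [P.IsPrime] : P.height ≤ (extendIdeal σ P).height := by
  let f : PrimeSpectrum R → PrimeSpectrum (MvPolynomial σ R) := fun q =>
    ⟨extendIdeal σ q.asIdeal, RingHom.ker_isPrime _⟩
  have hf : StrictMono f := by
    refine strictMono_of_le_iff_le fun q q' => ?_
    rw [← PrimeSpectrum.asIdeal_le_asIdeal, ← PrimeSpectrum.asIdeal_le_asIdeal]
    refine ⟨fun h F hF => mem_extendIdeal.2 fun e => h (mem_extendIdeal.1 hF e), fun h r hr => ?_⟩
    exact C_mem_extendIdeal.1 (h (C_mem_extendIdeal.2 hr))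
  have := Order.height_le_height_apply_of_strictMono f hf ⟨P, inferInstance⟩
  rwa [← PrimeSpectrum.height_eq_orderHeight, ← PrimeSpectrum.height_eq_orderHeight] at this

/-- In a regular local ring, the minimal generators of the maximal ideal are quasi-regular. -/
theorem MvPolynomial.IsHomogeneous.coeff_mem_maximalIdeal {R σ : Type*} [CommRing R]
    [IsLocalRing R] [IsNoetherianRing R] [Fintype σ] {x : σ → R}
    (hx : Ideal.span (Set.range x) = maximalIdeal R)
    (hdim : (Fintype.card σ : WithBot ℕ∞) = ringKrullDim R) {i : ℕ} {G : MvPolynomial σ R}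
    (hG : G.IsHomogeneous i) (h : MvPolynomial.eval x G ∈ maximalIdeal R ^ (i + 1))
    (e : σ →₀ ℕ) : G.coeff e ∈ maximalIdeal R := by
  classical
  by_contra he
  cases isEmpty_or_nonempty σ with
  | inl hσ =>
    have h0 : e = 0 := Subsingleton.elim _ _
    have hi : 0 = i := by
      have := hG (d := e) (fun h0 => he (h0 ▸ zero_mem _))
      simpa [h0] using this
    subst hi h0
    rw [MvPolynomial.eq_C_of_isEmpty G, eval_C, zero_add, pow_one] at h
    exact he h
  | inr hσ =>
    obtain ⟨j₀⟩ := hσ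
    let y : σ → MvPolynomial σ R := fun j => X j₀ * C (x j) - X j * C (x j₀)
    let M := extendIdeal σ (maximalIdeal R)
    have hxm (j) : x j ∈ maximalIdeal R := hx ▸ Ideal.subset_span ⟨j, rfl⟩
    have hCM (j) : C (x j) ∈ M := C_mem_extendIdeal.2 (hxm j)
    have hM : M.IsPrime := RingHom.ker_isPrime _
    let s : Finset (MvPolynomial σ R) := (Finset.univ.erase j₀).image y
    have hs : Ideal.span (s : Set (MvPolynomial σ R)) ≤ M := by
      rw [Ideal.span_le]
      intro z hz
      obtain ⟨j, -, rfl⟩ := Finset.mem_image.1 (Finset.mem_coe.1 hz)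
      exact sub_mem (M.mul_mem_left _ (hCM j)) (M.mul_mem_left _ (hCM j₀))
    obtain ⟨Q, hQ, hQM⟩ := Ideal.exists_minimalPrimes_le hs
    have hQp : Q.IsPrime := hQ.1.1
    have hyQ (j) : y j ∈ Q := by
      by_cases hj : j = j₀
      · simp [y, hj]
      · exact hQ.1.2 (Ideal.subset_span (Finset.mem_coe.2
          (Finset.mem_image_of_mem _ (Finset.mem_erase.2 ⟨hj, Finset.mem_univ _⟩))))
    have key {n : ℕ} {F : MvPolynomial σ R} (hF : F.IsHomogeneous n) :
        X j₀ ^ n * C (eval x F) - C (x j₀) ^ n * F ∈ Q := by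
      let q := Ideal.Quotient.mk Q
      rw [← Ideal.Quotient.eq]
      have h1 := hF.eval₂_mul_left (q.comp C) (q (X j₀)) (fun j => q (C (x j)))
      have h2 := hF.eval₂_mul_left (q.comp C) (q (C (x j₀))) (fun j => q (X j))
      have h3 : (fun j => q (X j₀) * q (C (x j))) = fun j => q (C (x j₀)) * q (X j) := by
        funext j
        rw [← map_mul, ← map_mul, mul_comm (C (x j₀))]
        exact Ideal.Quotient.eq.2 (hyQ j)
      have h4 : F.eval₂ (q.comp C) (fun j => q (C (x j))) = q (C (eval x F)) := by
        have := MvPolynomial.eval₂_comp_left (q.comp C) (RingHom.id R) x F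
        exact this.symm
      have h5 : F.eval₂ (q.comp C) (fun j => q (X j)) = q F := by
        have := MvPolynomial.eval₂_comp_left q C X F
        rw [MvPolynomial.eval₂_eta] at this
        exact this.symm
      rw [h3, h2, h4, h5] at h1
      simpa using h1.symm
    rw [← hx, Ideal.mem_span_pow_iff_exists_isHomogeneous] at h
    obtain ⟨E, hE, hEG⟩ := h
    have h1 := key hE
    have h2 := Q.mul_mem_left (X j₀) (key hG)
    rw [hEG] at h1
    have h3 : C (x j₀) ^ i * (X j₀ * G - C (x j₀) * E) ∈ Q := by
      convert sub_mem h1 h2 using 1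
      ring
    have hX : X j₀ ∉ M := fun hX => by
      have := mem_extendIdeal.1 hX (Finsupp.single j₀ 1)
      rw [coeff_X, if_pos rfl] at this
      exact (Ideal.ne_top_iff_one _).1 (Ideal.IsPrime.ne_top inferInstance) this
    have h4 : X j₀ * G - C (x j₀) * E ∉ Q := fun h4 => by
      have h5 : X j₀ * G ∈ M := by
        convert add_mem (hQM h4) (M.mul_mem_right E (hCM j₀)) using 1
        ring
      rcases hM.mem_or_mem h5 with h5 | h5
      · exact hX h5
      · exact he (mem_extendIdeal.1 h5 e)
    have h5 : C (x j₀) ∈ Q := hQp.mem_of_pow_mem _ ((hQp.mem_or_mem h3).resolve_right h4)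
    have h6 (j) : C (x j) ∈ Q := by
      refine (hQp.mem_or_mem (x := X j₀) ?_).resolve_left fun h => hX (hQM h)
      convert add_mem (hyQ j) (Q.mul_mem_left (X j) h5) using 1
      ring
    have h7 : maximalIdeal R ≤ Q.comap C := by
      rw [← hx, Ideal.span_le]
      rintro _ ⟨j, rfl⟩
      exact h6 j
    have h8 : M ≤ Q := fun F hF => by
      rw [F.as_sum]
      refine sum_mem fun d _ => ?_
      rw [← mul_one (coeff d F), ← C_mul_monomial]
      exact Q.mul_mem_right _ (h7 (mem_extendIdeal.1 hF d))
    obtain rfl : Q = M := le_antisymm hQM h8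
    have h9 := Ideal.height_le_card_of_mem_minimalPrimes_span_finset hQ
    have h10 := height_le_height_extendIdeal σ (maximalIdeal R)
    rw [← maximalIdeal_height_eq_ringKrullDim] at hdim
    have h11 : ((maximalIdeal R).height) = (Fintype.card σ : ℕ∞) := by
      exact_mod_cast hdim.symm
    have h12 : s.card < Fintype.card σ :=
      Finset.card_image_le.trans_lt (by
        rw [← Finset.card_univ]; exact Finset.card_erase_lt_of_mem (Finset.mem_univ _))
    rw [h11] at h10
    have := h10.trans h9
    exact absurd (by exact_mod_cast this) (not_le.2 h12)

/-- `j : A → B` exhibits `B` as the `ϖ`-adic completion of `A`. -/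
structure IsPrincipalCompletion {A B : Type*} [CommRing A] [CommRing B] (j : A →+* B) (ϖ : A) :
    Prop where
  complete : IsAdicComplete (Ideal.span {j ϖ}) B
  exists_dvd_sub (n : ℕ) (y : B) : ∃ a, j ϖ ^ n ∣ y - j a
  dvd_of_map_dvd (n : ℕ) (a : A) : j ϖ ^ n ∣ j a → ϖ ^ n ∣ a

theorem AdicCompletion.isPrincipalCompletion {A : Type*} [CommRing A] (ϖ : A) :
    IsPrincipalCompletion (algebraMap A (AdicCompletion (Ideal.span {ϖ}) A)) ϖ := by
  have hfg : (Ideal.span {ϖ}).FG := ⟨{ϖ}, by simp⟩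
  have key (n : ℕ) (y : AdicCompletion (Ideal.span {ϖ}) A) :
      algebraMap A (AdicCompletion (Ideal.span {ϖ}) A) ϖ ^ n ∣ y ↔
        AdicCompletion.eval (Ideal.span {ϖ}) A n y = 0 := by
    rw [← LinearMap.mem_ker, ← AdicCompletion.pow_smul_top_eq_ker_eval hfg,
      Ideal.span_singleton_pow, Submodule.ideal_span_singleton_smul,
      Submodule.mem_smul_pointwise_iff_exists, ← map_pow]
    simp only [Submodule.mem_top, true_and, Algebra.smul_def]
    exact ⟨fun ⟨z, hz⟩ => ⟨z, hz.symm⟩, fun ⟨z, hz⟩ => ⟨z, hz.symm⟩⟩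
  refine ⟨?_, fun n y => ?_, fun n a h => ?_⟩
  · have := AdicCompletion.isAdicComplete (M := A) hfg
    rw [← Set.image_singleton, ← Ideal.map_span]
    exact (IsAdicComplete.map_algebraMap_iff _ _).2 this
  · obtain ⟨a, ha⟩ := Submodule.Quotient.mk_surjective _ (AdicCompletion.eval _ A n y)
    refine ⟨a, (key _ _).2 ?_⟩
    rw [map_sub, ← ha, sub_eq_zero]
    rfl
  · have h1 : (Submodule.Quotient.mk a : A ⧸ (Ideal.span {ϖ} ^ n • ⊤ : Submodule A A)) = 0 :=
      (key _ _).1 h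
    rwa [Submodule.Quotient.mk_eq_zero, smul_eq_mul, Ideal.mul_top, Ideal.span_singleton_pow,
      Ideal.mem_span_singleton] at h1

namespace IsPrincipalCompletion

variable {A B : Type*} [CommRing A] [CommRing B] {j : A →+* B} {ϖ : A}
  (hj : IsPrincipalCompletion j ϖ)

include hj

theorem eq_zero {y : B} (h : ∀ n : ℕ, j ϖ ^ n ∣ y) : y = 0 := by
  have := hj.complete
  refine IsHausdorff.haus (I := Ideal.span {j ϖ}) inferInstance y fun n => ?_
  rw [SModEq.zero, smul_eq_mul, Ideal.mul_top, Ideal.span_singleton_pow,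
    Ideal.mem_span_singleton]
  exact h n

theorem exists_lim {f : ℕ → B} (h : ∀ {m n}, m ≤ n → j ϖ ^ m ∣ f m - f n) :
    ∃ L, ∀ n, j ϖ ^ n ∣ f n - L := by
  have := hj.complete
  obtain ⟨L, hL⟩ := IsPrecomplete.prec (I := Ideal.span {j ϖ}) inferInstance (f := f) (by
    intro m n hmn
    rw [SModEq.sub_mem, smul_eq_mul, Ideal.mul_top, Ideal.span_singleton_pow,
      Ideal.mem_span_singleton]
    exact h hmn)
  refine ⟨L, fun n => ?_⟩
  have := hL n
  rwa [SModEq.sub_mem, smul_eq_mul, Ideal.mul_top, Ideal.span_singleton_pow,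
      Ideal.mem_span_singleton] at this

theorem isUnit_one_add (y : B) : IsUnit (1 + j ϖ * y) := by
  have := hj.complete
  have := IsAdicComplete.le_jacobson_bot (Ideal.span {j ϖ}) (Ideal.mem_span_singleton_self (j ϖ))
  rw [Ideal.mem_jacobson_bot] at this
  rw [add_comm]
  exact this y

theorem exists_eq_mul_unit [IsDomain A] [ValuationRing A] {y : B} (hy : y ≠ 0) :
    ∃ a u n, y = j a * u ∧ IsUnit u ∧ a ∣ ϖ ^ n := by
  have : ∃ n : ℕ, ¬ j ϖ ^ n ∣ y := by
    by_contra! h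
    exact hy (hj.eq_zero h)
  obtain ⟨n, hn⟩ := this
  obtain ⟨a, w, ha⟩ := hj.exists_dvd_sub (n + 1) y
  have han : a ∣ ϖ ^ n := by
    refine (ValuationRing.dvd_total a (ϖ ^ n)).resolve_right fun h => hn ?_
    rw [← sub_add_cancel y (j a), ha]
    refine dvd_add (Dvd.intro _ (by rw [pow_succ, mul_assoc])) ?_
    rw [← map_pow]
    exact map_dvd j h
  obtain ⟨z, hz⟩ := id han
  refine ⟨a, 1 + j ϖ * (j z * w), n, ?_, hj.isUnit_one_add _, han⟩
  rw [← sub_add_cancel y (j a), ha, pow_succ, ← map_pow, hz, map_mul]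
  ring

theorem map_ne_zero [IsDomain A] (h0 : ϖ ≠ 0) (hu : ¬ IsUnit ϖ) {a : A} {n : ℕ} (ha : a ∣ ϖ ^ n) :
    j a ≠ 0 := fun h => by
  have h1 : j (ϖ ^ n) = 0 := by
    obtain ⟨z, hz⟩ := ha
    rw [hz, map_mul, h, zero_mul]
  have h2 := hj.dvd_of_map_dvd (n + 1) (ϖ ^ n) (h1 ▸ dvd_zero _)
  rw [pow_succ] at h2
  obtain ⟨w, hw⟩ := h2
  rw [mul_assoc] at hw
  have := mul_left_cancel₀ (pow_ne_zero n h0) ((mul_one _).trans hw)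
  exact hu (IsUnit.of_mul_eq_one _ this.symm)

theorem isDomain [IsDomain A] [ValuationRing A] (h0 : ϖ ≠ 0) (hu : ¬ IsUnit ϖ) : IsDomain B := by
  have : Nontrivial B := ⟨⟨j ϖ, 0, hj.map_ne_zero h0 hu (a := ϖ) (n := 1) (by simp)⟩⟩
  have : NoZeroDivisors B := by
    refine ⟨fun {y z} h => ?_⟩
    by_contra! hyz
    obtain ⟨a, u, n, rfl, hu1, ha⟩ := hj.exists_eq_mul_unit hyz.1
    obtain ⟨b, v, m, rfl, hv1, hb⟩ := hj.exists_eq_mul_unit hyz.2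
    refine hj.map_ne_zero h0 hu (a := a * b) (n := n + m) (pow_add ϖ n m ▸ mul_dvd_mul ha hb) ?_
    rw [map_mul]
    refine ((hu1.mul hv1).mul_left_eq_zero).1 ?_
    rw [← h]; ring
  exact NoZeroDivisors.to_isDomain B

theorem valuationRing [IsDomain A] [ValuationRing A] [IsDomain B] : ValuationRing B := by
  rw [ValuationRing.iff_dvd_total]
  refine ⟨fun y z => ?_⟩
  by_cases hy : y = 0
  · exact Or.inr (hy ▸ dvd_zero _)
  by_cases hz : z = 0
  · exact Or.inl (hz ▸ dvd_zero _)
  obtain ⟨a, u, n, rfl, hu1, ha⟩ := hj.exists_eq_mul_unit hy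
  obtain ⟨b, v, m, rfl, hv1, hb⟩ := hj.exists_eq_mul_unit hz
  rw [hu1.mul_right_dvd, hv1.dvd_mul_right, hv1.mul_right_dvd, hu1.dvd_mul_right]
  exact (ValuationRing.dvd_total a b).imp (map_dvd j) (map_dvd j)

theorem not_isUnit_map (hu : ¬ IsUnit ϖ) : ¬ IsUnit (j ϖ) := fun h => hu <| by
  have := hj.dvd_of_map_dvd 1 1 (by rw [pow_one]; exact h.dvd)
  rw [pow_one] at this
  exact isUnit_of_dvd_one this

theorem ringKrullDim_eq_one [IsDomain A] [ValuationRing A] [IsDomain B] [ValuationRing B]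
    (h0 : ϖ ≠ 0) (hu : ¬ IsUnit ϖ) (hr : ∀ a, ¬ IsUnit a → ∃ n, ϖ ∣ a ^ n) :
    ringKrullDim B = 1 := by
  rw [ringKrullDim_eq_one_iff_of_isLocalRing_isDomain]
  refine ⟨fun h => ?_, fun x hx y hy => ?_⟩
  · refine hj.not_isUnit_map hu ?_
    obtain ⟨b, hb⟩ := h.mul_inv_cancel (hj.map_ne_zero h0 hu (a := ϖ) (n := 1) (by simp))
    exact IsUnit.of_mul_eq_one _ hb
  · obtain ⟨a, u, n, rfl, hu1, ha⟩ := hj.exists_eq_mul_unit hx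
    obtain ⟨b, w, hb⟩ := hj.exists_dvd_sub 1 y
    rw [pow_one] at hb
    have hbu : ¬ IsUnit b := fun h => by
      obtain ⟨v, hv⟩ := (h.map j).exists_right_inv
      refine (IsLocalRing.mem_maximalIdeal _).1 hy ?_
      have : y = j b * (1 + j ϖ * (v * w)) := by
        linear_combination hb - j ϖ * w * hv
      rw [this]
      exact (h.map j).mul (hj.isUnit_one_add _)
    obtain ⟨k, hk⟩ := hr b hbu
    have hyk : j ϖ ∣ y ^ k := by
      have h1 : j ϖ ∣ y ^ k - j b ^ k := (Dvd.intro _ hb.symm).trans (sub_dvd_pow_sub_pow _ _ _)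
      have h2 : j ϖ ∣ j b ^ k := by rw [← map_pow]; exact map_dvd j hk
      simpa using dvd_add h1 h2
    refine ⟨k * n, Ideal.mem_span_singleton.2 ?_⟩
    rw [hu1.mul_right_dvd, pow_mul]
    refine (map_dvd j ha).trans ?_
    rw [map_pow]
    exact pow_dvd_pow_of_dvd hyk n

open Polynomial in
theorem exists_monic_approx [Nontrivial A] [Nontrivial B] {f : B[X]} (hf : f.Monic) (N : ℕ) :
    ∃ g : A[X], g.Monic ∧ g.natDegree = f.natDegree ∧
      ∀ y, j ϖ ^ N ∣ f.eval y - (g.map j).eval y := by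
  choose c hc using hj.exists_dvd_sub N
  let q : A[X] := ∑ i : Fin f.natDegree, C (c (f.coeff i)) * X ^ (i : ℕ)
  have hq : q.degree < f.natDegree := degree_sum_fin_lt _
  refine ⟨X ^ f.natDegree + q, monic_X_pow_add hq, ?_, fun y => ?_⟩
  · refine natDegree_eq_of_degree_eq_some ?_
    rw [degree_add_eq_left_of_degree_lt (by rwa [degree_X_pow]), degree_X_pow]
  · have e : f.eval y = (X ^ f.natDegree +
        ∑ i ∈ Finset.range f.natDegree, C (f.coeff i) * X ^ i).eval y :=
      congrArg (eval y) hf.as_sum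
    rw [e, ← Fin.sum_univ_eq_sum_range fun i => C (f.coeff i) * X ^ i]
    simp only [q, Polynomial.map_add, Polynomial.map_pow, map_X,
      Polynomial.map_sum, Polynomial.map_mul, map_C, eval_add, eval_pow, eval_X, eval_finsetSum,
      eval_mul, eval_C, add_sub_add_left_eq_sub, ← Finset.sum_sub_distrib, ← sub_mul]
    exact Finset.dvd_sum fun i _ => (hc _).mul_right _

end IsPrincipalCompletion

theorem Multiset.exists_dvd_of_pow_card_dvd_prod {A : Type*} [CommRing A] [IsDomain A]
    [ValuationRing A] {c : A} (hc : c ≠ 0) {s : Multiset A} (hs : s ≠ 0)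
    (h : c ^ card s ∣ s.prod) : ∃ b ∈ s, c ∣ b := by
  by_contra! H
  have key : ∀ s : Multiset A, (∀ b ∈ s, ¬ c ∣ b) →
      ∃ z, c ^ card s = s.prod * z ∧ (s ≠ 0 → ¬ IsUnit z) := by
    intro s
    induction s using Multiset.induction with
    | empty => exact fun _ => ⟨1, by simp⟩
    | cons b s ih =>
      intro h
      obtain ⟨z, hz, -⟩ := ih fun b hb => h b (Multiset.mem_cons_of_mem hb)
      have hb := h b (Multiset.mem_cons_self b s)
      obtain ⟨w, hw⟩ := (ValuationRing.dvd_total c b).resolve_left hb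
      refine ⟨z * w, ?_, fun _ hzw => hb ?_⟩
      · rw [Multiset.card_cons, pow_succ, hz, Multiset.prod_cons]
        linear_combination s.prod * z * hw
      · rw [hw]
        exact (isUnit_of_mul_isUnit_right hzw).mul_right_dvd.2 dvd_rfl
  obtain ⟨z, hz, hzu⟩ := key s H
  obtain ⟨w, hw⟩ := h
  refine hzu hs (IsUnit.of_mul_eq_one w ?_)
  refine mul_left_cancel₀ (pow_ne_zero (card s) hc) ?_
  rw [mul_one]
  nth_rewrite 2 [hz]
  rw [hw]
  ring

open Polynomial in
theorem Polynomial.Monic.splits_of_forall_exists_root {A : Type*} [CommRing A] [IsDomain A]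
    (h : ∀ f : A[X], f.Monic → f.natDegree ≠ 0 → ∃ r, f.eval r = 0) {f : A[X]} (hf : f.Monic) :
    f.Splits := by
  induction hn : f.natDegree generalizing f with
  | zero => rw [hf.natDegree_eq_zero.1 hn]; exact Splits.one
  | succ n ih =>
    obtain ⟨r, hr⟩ := h f hf (by omega)
    obtain ⟨g, rfl⟩ := dvd_iff_isRoot.2 hr
    have hg : g.Monic := (monic_X_sub_C r).of_mul_monic_left hf
    refine (Splits.X_sub_C r).mul (ih hg ?_)
    rw [(monic_X_sub_C r).natDegree_mul hg, natDegree_X_sub_C] at hn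
    omega

open Polynomial in
theorem IsPrincipalCompletion.exists_root {A B : Type*} [CommRing A] [CommRing B] {j : A →+* B}
    {ϖ : A} (hj : IsPrincipalCompletion j ϖ) [IsDomain A] [ValuationRing A] [Nontrivial B]
    (h0 : ϖ ≠ 0) (hA : ∀ f : A[X], f.Monic → f.Splits) {f : B[X]} (hf : f.Monic)
    (hd : f.natDegree ≠ 0) : ∃ r, f.eval r = 0 := by
  have step (k : ℕ) (a : A) (ha : j ϖ ^ (k * f.natDegree) ∣ f.eval (j a)) :
      ∃ b, j ϖ ^ ((k + 1) * f.natDegree) ∣ f.eval (j b) ∧ ϖ ^ k ∣ a - b := by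
    obtain ⟨g, hg, hgd, hfg⟩ := hj.exists_monic_approx hf ((k + 1) * f.natDegree)
    have h1 : ϖ ^ (k * f.natDegree) ∣ g.eval a := by
      refine hj.dvd_of_map_dvd _ _ ?_
      have := dvd_sub ha ((pow_dvd_pow _ (by gcongr; omega)).trans (hfg (j a)))
      rwa [sub_sub_cancel, eval_map_apply] at this
    have hs := hA g hg
    rw [hs.eq_prod_roots_of_monic hg, eval_multiset_prod, Multiset.map_map, ← hgd,
      hs.natDegree_eq_card_roots, pow_mul] at h1
    obtain ⟨c, hc, hdvd⟩ := Multiset.exists_dvd_of_pow_card_dvd_prod (pow_ne_zero k h0)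
      (s := g.roots.map (eval a ∘ fun b => X - C b)) (by
        rw [Ne, ← Multiset.card_eq_zero, Multiset.card_map, ← hs.natDegree_eq_card_roots, hgd]
        exact hd) (by rwa [Multiset.card_map])
    obtain ⟨b, hb, rfl⟩ := Multiset.mem_map.1 hc
    refine ⟨b, ?_, by simpa using hdvd⟩
    have := hfg (j b)
    rwa [eval_map_apply, (mem_roots'.1 hb).2.eq_zero, map_zero, sub_zero] at this
  choose! b hb1 hb2 using step
  let s : ℕ → A := fun n => Nat.rec 0 (fun k a => b k a) n
  have hs (k : ℕ) : j ϖ ^ (k * f.natDegree) ∣ f.eval (j (s k)) := by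
    induction k with
    | zero => simp
    | succ k ih => exact hb1 k (s k) ih
  have hs2 (k : ℕ) : ϖ ^ k ∣ s k - s (k + 1) := hb2 k (s k) (hs k)
  obtain ⟨L, hL⟩ := hj.exists_lim (f := fun k => j (s k)) (by
    intro m n hmn
    rw [← map_pow, ← map_sub]
    refine map_dvd j ?_
    induction n, hmn using Nat.le_induction with
    | base => simp
    | succ n hmn ih =>
      rw [← sub_add_sub_cancel _ (s n)]
      exact dvd_add ih ((pow_dvd_pow _ hmn).trans (hs2 n)))
  refine ⟨L, hj.eq_zero fun n => ?_⟩
  have h1 := (hL n).trans (sub_dvd_eval_sub _ _ f)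
  have h2 := (pow_dvd_pow (j ϖ) (Nat.le_mul_of_pos_right n (Nat.pos_of_ne_zero hd))).trans (hs n)
  simpa using dvd_sub h2 h1

open Polynomial in
theorem IsAlgClosed.of_isFractionRing {A K : Type*} [CommRing A] [IsDomain A] [Field K]
    [Algebra A K] [IsFractionRing A K]
    (h : ∀ f : A[X], f.Monic → f.natDegree ≠ 0 → ∃ r, f.eval r = 0) : IsAlgClosed K := by
  refine IsAlgClosed.of_exists_root K fun p hp hirr => ?_
  let c := IsLocalization.commonDenom (nonZeroDivisors A) p.support p.coeff
  obtain ⟨q, hq, hqd, hqm⟩ := lifts_and_natDegree_eq_and_monic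
    (IsLocalization.scaleRoots_commonDenom_mem_lifts (nonZeroDivisors A) p
      ⟨1, by rw [map_one, hp.leadingCoeff]⟩) ((monic_scaleRoots_iff _).2 hp)
  obtain ⟨r, hr⟩ := h q hqm (by
    rw [hqd, natDegree_scaleRoots]; exact hirr.natDegree_pos.ne')
  have hc : algebraMap A K c ≠ 0 :=
    IsFractionRing.to_map_ne_zero_of_mem_nonZeroDivisors c.2
  refine ⟨algebraMap A K r / algebraMap A K c, ?_⟩
  have h1 := scaleRoots_eval_mul p (algebraMap A K r / algebraMap A K c) (algebraMap A K c)
  rw [mul_div_cancel₀ _ hc, ← hq, eval_map_apply, hr, map_zero] at h1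
  exact (mul_eq_zero.1 h1.symm).resolve_left (pow_ne_zero _ hc)

theorem ValuationRing.radical_isPrime {A : Type*} [CommRing A] [IsDomain A] [ValuationRing A]
    {I : Ideal A} (hI : I ≠ ⊤) : I.radical.IsPrime := by
  refine ⟨fun h => hI (Ideal.radical_eq_top.1 h), fun {x y} h => ?_⟩
  obtain ⟨n, hn⟩ := h
  rcases ValuationRing.dvd_total x y with ⟨c, rfl⟩ | ⟨c, rfl⟩
  · refine Or.inr ⟨n + n, ?_⟩
    have := I.mul_mem_left (c ^ n) hn
    rwa [show c ^ n * (x * (x * c)) ^ n = (x * c) ^ (n + n) by ring] at this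
  · refine Or.inl ⟨n + n, ?_⟩
    have := I.mul_mem_left (c ^ n) hn
    rwa [show c ^ n * (y * c * y) ^ n = (y * c) ^ (n + n) by ring] at this

open Polynomial in
theorem ValuationSubring.monic_splits {L : Type*} [Field L] [IsAlgClosed L]
    (A : ValuationSubring L) {f : A[X]} (hf : f.Monic) : f.Splits := by
  refine Monic.splits_of_forall_exists_root (fun f hf hd => ?_) hf
  obtain ⟨r, hr⟩ := IsAlgClosed.exists_eval₂_eq_zero_of_injective (algebraMap A L)
    (IsFractionRing.injective A L) f (by
      rw [degree_eq_natDegree hf.ne_zero]; exact_mod_cast hd)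
  obtain ⟨r, rfl⟩ := (IsIntegrallyClosed.isIntegral_iff (R := A) (K := L)).1 ⟨f, hf, hr⟩
  refine ⟨r, IsFractionRing.injective A L ?_⟩
  rw [map_zero, ← hr, eval₂_at_apply]

universe u in
open Polynomial in
/-- A nonzero nonunit of a domain becomes a pseudo-uniformizer of some valuation ring with
algebraically closed fraction field. -/
theorem exists_valuationRing_pseudoUniformizer {W : Type u} [CommRing W] [IsDomain W] {ϖ : W}
    (h0 : ϖ ≠ 0) (hu : ¬ IsUnit ϖ) :
    ∃ (A : Type u) (_ : CommRing A) (_ : IsDomain A) (_ : ValuationRing A) (j : W →+* A),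
      j ϖ ≠ 0 ∧ ¬ IsUnit (j ϖ) ∧ (∀ a, ¬ IsUnit a → ∃ n, j ϖ ∣ a ^ n) ∧
      ∀ f : A[X], f.Monic → f.Splits := by
  let L := AlgebraicClosure (FractionRing W)
  let i : W →+* L := (algebraMap (FractionRing W) L).comp (algebraMap W (FractionRing W))
  have hi : Function.Injective i :=
    (algebraMap (FractionRing W) L).injective.comp (IsFractionRing.injective W _)
  let e : W ≃+* i.range := RingEquiv.ofBijective i.rangeRestrict
    ⟨fun a b h => hi (congrArg Subtype.val h), i.rangeRestrict_surjective⟩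
  obtain ⟨B, hB, hB'⟩ := Ideal.image_subset_nonunits_valuationSubring
    (Ideal.span {e ϖ}) (by
      rw [Ne, Ideal.span_singleton_eq_top]
      exact fun h => hu ((MulEquiv.isUnit_map e).1 h))
  let jB : W →+* B := i.codRestrict B fun w => hB (Subtype.property (e w))
  have hjB : ¬ IsUnit (jB ϖ) := by
    have := hB' ⟨e ϖ, Ideal.mem_span_singleton_self _, rfl⟩
    rw [← B.image_maximalIdeal] at this
    obtain ⟨y, hy, hye⟩ := this
    obtain rfl : y = jB ϖ := Subtype.ext hye
    exact hy
  have hP : (Ideal.span {jB ϖ}).radical.IsPrime := ValuationRing.radical_isPrime (by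
    rwa [Ne, Ideal.span_singleton_eq_top])
  let P := (Ideal.span {jB ϖ}).radical
  refine ⟨B.ofPrime P, inferInstance, inferInstance, inferInstance,
    (algebraMap B (B.ofPrime P)).comp jB, ?_, ?_, fun a ha => ?_,
    fun f hf => ValuationSubring.monic_splits _ hf⟩
  · intro h
    refine h0 (hi ?_)
    rw [map_zero]
    exact congrArg Subtype.val h
  · rw [RingHom.comp_apply, IsLocalization.AtPrime.isUnit_to_map_iff (B.ofPrime P) P]
    exact fun h => h (Ideal.le_radical (Ideal.mem_span_singleton_self _))
  · obtain ⟨b, s, rfl⟩ := IsLocalization.exists_mk'_eq P.primeCompl a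
    rw [IsLocalization.AtPrime.isUnit_mk'_iff (B.ofPrime P) P] at ha
    obtain ⟨n, hn⟩ : b ∈ P := not_not.1 ha
    obtain ⟨c, hc⟩ := Ideal.mem_span_singleton.1 hn
    refine ⟨n, ?_⟩
    rw [← IsLocalization.mk'_pow, hc, IsLocalization.mk'_eq_mul_mk'_one, map_mul, mul_assoc]
    exact Dvd.intro _ rfl

universe u in
/-- A nonzero nonunit of a domain becomes a pseudo-uniformizer of some complete valuation ring of
rank one with algebraically closed fraction field. -/
theorem exists_complete_valuationRing_pseudoUniformizer {W : Type u} [CommRing W] [IsDomain W]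
    {ϖ : W} (h0 : ϖ ≠ 0) (hu : ¬ IsUnit ϖ) :
    ∃ (V : Type u) (_ : CommRing V) (_ : IsDomain V) (_ : ValuationRing V) (φ : W →+* V),
      φ ϖ ≠ 0 ∧ ¬ IsUnit (φ ϖ) ∧ IsAdicComplete (Ideal.span {φ ϖ}) V ∧ ringKrullDim V = 1 ∧
      IsAlgClosed (FractionRing V) ∧ ∀ f : Polynomial V, f.Monic → f.Splits := by
  obtain ⟨A, _, _, _, j, hj0, hju, hjr, hA⟩ := exists_valuationRing_pseudoUniformizer h0 hu
  have hc := AdicCompletion.isPrincipalCompletion (j ϖ)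
  have : IsDomain (AdicCompletion (Ideal.span {j ϖ}) A) := hc.isDomain hj0 hju
  have : ValuationRing (AdicCompletion (Ideal.span {j ϖ}) A) := hc.valuationRing
  have hroot (f : Polynomial (AdicCompletion (Ideal.span {j ϖ}) A)) (hf : f.Monic)
      (hd : f.natDegree ≠ 0) : ∃ r, f.eval r = 0 := hc.exists_root hj0 hA hf hd
  exact ⟨AdicCompletion (Ideal.span {j ϖ}) A, inferInstance, inferInstance, inferInstance,
    (algebraMap A _).comp j, hc.map_ne_zero hj0 hju (a := j ϖ) (n := 1) (by simp),
    hc.not_isUnit_map hju, hc.complete, hc.ringKrullDim_eq_one hj0 hju hjr,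
    IsAlgClosed.of_isFractionRing hroot,
    fun f hf => Polynomial.Monic.splits_of_forall_exists_root hroot hf⟩

open Polynomial in
theorem IsLocalRing.infinite_residueField {V : Type*} [CommRing V] [IsDomain V] [IsLocalRing V]
    (hV : ∀ f : V[X], f.Monic → f.Splits) : Infinite (ResidueField V) := by
  have : IsAlgClosed (ResidueField V) := by
    refine IsAlgClosed.of_exists_root _ fun q hq hirr => ?_
    obtain ⟨f, rfl, hfd, hf⟩ := lifts_and_natDegree_eq_and_monic
      ((mem_lifts q).2 (map_surjective _ residue_surjective q)) hq
    obtain ⟨r, hr⟩ := (hV f hf).exists_eval_eq_zero (by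
      rw [degree_eq_natDegree hf.ne_zero, hfd]
      exact_mod_cast hirr.natDegree_pos.ne')
    exact ⟨residue V r, by rw [eval_map_apply, hr, map_zero]⟩
  exact IsAlgClosed.instInfinite

theorem IsLocalRing.exists_isUnit_eval₂ {W V σ : Type*} [CommRing W] [CommRing V] [IsLocalRing V]
    [Infinite (ResidueField V)] (φ : W →+* V) {G : MvPolynomial σ W} {e : σ →₀ ℕ}
    (he : IsUnit (G.coeff e)) : ∃ c : σ → V, IsUnit (G.eval₂ φ c) := by
  by_contra! H
  have h0 : G.map ((residue V).comp φ) = 0 := MvPolynomial.funext fun z => by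
    choose c hc using fun i => residue_surjective (z i)
    obtain rfl : residue V ∘ c = z := funext hc
    rw [MvPolynomial.eval_map, map_zero, ← MvPolynomial.eval₂_comp_left,
      residue_eq_zero_iff]
    exact H c
  have h1 := congrArg (MvPolynomial.coeff e) h0
  rw [MvPolynomial.coeff_map, MvPolynomial.coeff_zero] at h1
  exact ((he.map ((residue V).comp φ)).ne_zero) h1

open Polynomial in
theorem Polynomial.exists_dvd_eval_sub_of_splits {V : Type*} [CommRing V] [IsDomain V]
    (hV : ∀ f : V[X], f.Monic → f.Splits) {F : V[X]} (hF : F.coeff 0 = 0) {t : V} (ht0 : t ≠ 0)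
    (ht : ¬ IsUnit t) (N : ℕ) :
    ∃ a, a ≠ 0 ∧ ¬ IsUnit a ∧ a ∣ t ∧ a ^ N ∣ F.eval a - t := by
  have hd : (F - C t).degree < ((max F.natDegree N + 1 : ℕ) : WithBot ℕ) := by
    refine (degree_sub_le _ _).trans_lt (max_lt ?_ (degree_C_le.trans_lt (by norm_cast; omega)))
    refine degree_le_natDegree.trans_lt ?_
    norm_cast
    omega
  have hm : (X ^ (max F.natDegree N + 1) + (F - C t)).Monic := monic_X_pow_add hd
  have hs := hV _ hm
  have h0 : (X ^ (max F.natDegree N + 1) + (F - C t)).eval 0 = -t := by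
    simp [← coeff_zero_eq_eval_zero, hF]
  obtain ⟨a, ha, hau⟩ : ∃ a ∈ (X ^ (max F.natDegree N + 1) + (F - C t)).roots, ¬ IsUnit a := by
    by_contra! H
    rw [hs.eq_prod_roots_of_monic hm, eval_multiset_prod, Multiset.map_map] at h0
    refine ht (IsUnit.neg_iff t |>.1 (h0 ▸ ?_))
    refine Multiset.prod_induction _ _ (fun _ _ => IsUnit.mul) isUnit_one fun b hb => ?_
    obtain ⟨c, hc, rfl⟩ := Multiset.mem_map.1 hb
    simpa using (H c hc)
  have hroot : a ^ (max F.natDegree N + 1) + (F.eval a - t) = 0 := by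
    simpa using (mem_roots'.1 ha).2
  have haF : a ∣ F.eval a := by
    obtain ⟨Q, rfl⟩ := X_dvd_iff.2 hF
    simp
  refine ⟨a, ?_, hau, ?_, ?_⟩
  · rintro rfl
    rw [← coeff_zero_eq_eval_zero, hF, zero_pow (by omega)] at hroot
    exact ht0 (by simpa using hroot)
  · have : t = a ^ (max F.natDegree N + 1) + F.eval a := by linear_combination -hroot
    rw [this]
    exact dvd_add (dvd_pow_self _ (by omega)) haF
  · have : F.eval a - t = - a ^ (max F.natDegree N + 1) := by linear_combination hroot
    rw [this, dvd_neg]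
    exact pow_dvd_pow _ (by omega)

open MvPolynomial in
theorem MvPolynomial.eval₂_mem_pow_of_mem_pow_idealOfVars {W S σ : Type*} [CommRing W] [CommRing S]
    (f : W →+* S) {x : σ → S} {I : Ideal S} (hx : ∀ j, x j ∈ I) {n : ℕ} {G : MvPolynomial σ W}
    (hG : G ∈ idealOfVars σ W ^ n) : G.eval₂ f x ∈ I ^ n := by
  have h1 : (idealOfVars σ W).map (eval₂Hom f x) ≤ I := by
    rw [idealOfVars, Ideal.map_span, Ideal.span_le]
    rintro _ ⟨_, ⟨j, rfl⟩, rfl⟩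
    simpa using hx j
  have h2 := Ideal.pow_right_mono h1 n
  rw [← Ideal.map_pow] at h2
  exact h2 (Ideal.mem_map_of_mem (eval₂Hom f x) hG)

theorem MvPolynomial.IsHomogeneous.mem_pow_idealOfVars {W σ : Type*} [CommRing W] {n : ℕ}
    {G : MvPolynomial σ W} (hG : G.IsHomogeneous n) : G ∈ idealOfVars σ W ^ n := by
  rw [mem_pow_idealOfVars_iff']
  exact fun e he => hG.coeff_eq_zero he.ne

section CoefficientRing

open MvPolynomial

variable {W R σ : Type*} [CommRing W] [CommRing R] [IsLocalRing R] {ι : W →+* R} {x : σ → R}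
  (hx : Ideal.span (Set.range x) = maximalIdeal R)
  (hι : ∀ r, ∃ w, r - ι w ∈ maximalIdeal R)

include hx hι

theorem IsLocalRing.exists_isHomogeneous_sub_eval₂_mem {i : ℕ} {y : R}
    (hy : y ∈ maximalIdeal R ^ i) :
    ∃ G : MvPolynomial σ W, G.IsHomogeneous i ∧ y - G.eval₂ ι x ∈ maximalIdeal R ^ (i + 1) := by
  have hy' := hy
  rw [← hx, Ideal.mem_span_pow_iff_exists_isHomogeneous] at hy'
  obtain ⟨P, hP, rfl⟩ := hy'
  choose w hw using hι
  have hdeg {e} (he : e ∈ P.support) : ∑ j ∈ e.support, e j = i := by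
    simpa [Finsupp.weight_apply, Finsupp.sum] using hP (mem_support_iff.mp he)
  refine ⟨∑ e ∈ P.support, monomial e (w (P.coeff e)), IsHomogeneous.sum _ _ _ fun e he =>
    isHomogeneous_monomial _ (hdeg he), ?_⟩
  rw [eval_eq, eval₂_sum, ← Finset.sum_sub_distrib]
  refine Ideal.sum_mem _ fun e he => ?_
  rw [eval₂_monomial, Finsupp.prod, ← sub_mul, pow_succ']
  refine Ideal.mul_mem_mul (hw _) ?_
  rw [← hdeg he, ← Finset.prod_pow_eq_pow_sum]
  refine Ideal.prod_mem_prod fun j _ => Ideal.pow_mem_pow ?_ _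
  rw [← hx]
  exact Ideal.subset_span ⟨j, rfl⟩

theorem IsLocalRing.exists_mem_pow_idealOfVars_sub_eval₂_mem (i n : ℕ) {y : R}
    (hy : y ∈ maximalIdeal R ^ n) :
    ∃ G ∈ idealOfVars σ W ^ n, y - G.eval₂ ι x ∈ maximalIdeal R ^ (n + i) := by
  induction i with
  | zero => exact ⟨0, zero_mem _, by simpa using hy⟩
  | succ i ih =>
    obtain ⟨G, hG, hyG⟩ := ih
    obtain ⟨H, hH, hyH⟩ := exists_isHomogeneous_sub_eval₂_mem hx hι hyG
    refine ⟨G + H, add_mem hG (Ideal.pow_le_pow_right (Nat.le_add_right n i)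
      hH.mem_pow_idealOfVars), ?_⟩
    rwa [eval₂_add, ← sub_sub]

omit hι in
/-- Modulo `𝔪 ^ N`, the relations among a regular system of parameters with coefficients in `W`
are generated by a single equation for the uniformizer of `W`. -/
theorem IsLocalRing.mem_span_sup_pow_of_eval₂_mem [IsNoetherianRing R] [Fintype σ]
    (hdim : (Fintype.card σ : WithBot ℕ∞) = ringKrullDim R) {ϖ : W}
    (hϖ : ∀ w, ι w ∈ maximalIdeal R → ϖ ∣ w) {N : ℕ} {f : MvPolynomial σ W}
    (hf : f ∈ idealOfVars σ W) (hfN : ι ϖ - f.eval₂ ι x ∈ maximalIdeal R ^ N)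
    {h : MvPolynomial σ W} (hh : h.eval₂ ι x ∈ maximalIdeal R ^ N) {i : ℕ} (hi : i ≤ N) :
    h ∈ Ideal.span {C ϖ - f} ⊔ idealOfVars σ W ^ i := by
  have hxm (j) : x j ∈ maximalIdeal R := hx ▸ Ideal.subset_span ⟨j, rfl⟩
  induction i with
  | zero => simp
  | succ i ih =>
    obtain ⟨q, hq, r, hr, rfl⟩ := Submodule.mem_sup.1 (ih (by omega))
    obtain ⟨q, rfl⟩ := Ideal.mem_span_singleton.1 hq
    refine add_mem (Ideal.mem_sup_left hq) ?_
    have hrN : r.eval₂ ι x ∈ maximalIdeal R ^ N := by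
      rw [eval₂_add, eval₂_mul, eval₂_sub, eval₂_C] at hh
      exact (Ideal.add_mem_iff_right _ (Ideal.mul_mem_right _ _ hfN)).1 hh
    have hr' : r - homogeneousComponent i r ∈ idealOfVars σ W ^ (i + 1) := by
      rw [mem_pow_idealOfVars_iff'] at hr ⊢
      intro e he
      rw [coeff_sub, coeff_homogeneousComponent]
      split_ifs with h
      · exact sub_self _
      · rw [sub_zero]
        exact hr e (by omega)
    have hc : (homogeneousComponent i r).eval₂ ι x ∈ maximalIdeal R ^ (i + 1) := by
      rw [← sub_sub_cancel r (homogeneousComponent i r), eval₂_sub]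
      exact sub_mem (Ideal.pow_le_pow_right hi hrN)
        (eval₂_mem_pow_of_mem_pow_idealOfVars ι hxm hr')
    obtain ⟨s, hs⟩ : C ϖ ∣ homogeneousComponent i r := by
      rw [C_dvd_iff_dvd_coeff]
      intro e
      refine hϖ _ ?_
      rw [← coeff_map]
      refine ((homogeneousComponent_isHomogeneous i r).map ι).coeff_mem_maximalIdeal hx hdim ?_ e
      rwa [eval_map]
    have hs' : homogeneousComponent i r = C ϖ * homogeneousComponent i s := by
      rw [← homogeneousComponent_C_mul, ← hs,
        homogeneousComponent_eq_self (homogeneousComponent_isHomogeneous i r)]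
    have hfs : f * homogeneousComponent i s ∈ idealOfVars σ W ^ (i + 1) := by
      rw [pow_succ']
      exact Ideal.mul_mem_mul hf (homogeneousComponent_isHomogeneous i s).mem_pow_idealOfVars
    have : r = (C ϖ - f) * homogeneousComponent i s +
        (f * homogeneousComponent i s + (r - homogeneousComponent i r)) := by
      rw [hs']; ring
    rw [this]
    exact add_mem (Ideal.mem_sup_left (Ideal.mul_mem_right _ _ (Ideal.mem_span_singleton_self _)))
      (Ideal.mem_sup_right (add_mem hfs hr'))

/-- Ring homomorphisms out of `R ⧸ 𝔪 ^ N` can be prescribed on a regular system of parameters,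
subject only to the equation satisfied by the uniformizer of `W`. -/
theorem IsLocalRing.exists_ringHom_eval₂_eq [IsNoetherianRing R] [Fintype σ]
    (hdim : (Fintype.card σ : WithBot ℕ∞) = ringKrullDim R) {ϖ : W}
    (hϖ : ∀ w, ι w ∈ maximalIdeal R → ϖ ∣ w) {N : ℕ} {f : MvPolynomial σ W}
    (hf : f ∈ idealOfVars σ W) (hfN : ι ϖ - f.eval₂ ι x ∈ maximalIdeal R ^ N)
    {S : Type*} [CommRing S] (φ : W →+* S) {z : σ → S} {I : Ideal S} (hI : I ^ N = ⊥)
    (hz : ∀ j, z j ∈ I) (hfz : f.eval₂ φ z = φ ϖ) :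
    ∃ g : R →+* S, (∀ h : MvPolynomial σ W, g (h.eval₂ ι x) = h.eval₂ φ z) ∧
      ∀ y ∈ maximalIdeal R ^ N, g y = 0 := by
  let π : MvPolynomial σ W →+* R ⧸ maximalIdeal R ^ N :=
    (Ideal.Quotient.mk _).comp (eval₂Hom ι x)
  have hπ : Function.Surjective π := fun y => by
    obtain ⟨y, rfl⟩ := Ideal.Quotient.mk_surjective y
    obtain ⟨G, -, hG⟩ := exists_mem_pow_idealOfVars_sub_eval₂_mem hx hι N 0 (y := y) (by simp)
    rw [zero_add] at hG
    exact ⟨G, ((Ideal.Quotient.mk_eq_mk_iff_sub_mem _ _).2 hG).symm⟩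
  have hker : RingHom.ker π ≤ RingHom.ker (eval₂Hom φ z) := fun h hh => by
    have := mem_span_sup_pow_of_eval₂_mem hx hdim hϖ hf hfN
      (Ideal.Quotient.eq_zero_iff_mem.1 hh) le_rfl
    refine (sup_le ?_ fun G hG => ?_ : _ ≤ RingHom.ker (eval₂Hom φ z)) this
    · rw [Ideal.span_singleton_le_iff_mem, RingHom.mem_ker, map_sub, coe_eval₂Hom, eval₂_C, hfz,
        sub_self]
    · have := eval₂_mem_pow_of_mem_pow_idealOfVars φ hz hG
      rwa [hI] at this
  refine ⟨(π.liftOfSurjective hπ ⟨eval₂Hom φ z, hker⟩).comp (Ideal.Quotient.mk _), fun h => ?_,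
    fun y hy => ?_⟩
  · exact π.liftOfSurjective_comp_apply hπ ⟨eval₂Hom φ z, hker⟩ h
  · rw [RingHom.comp_apply, Ideal.Quotient.eq_zero_iff_mem.2 hy, map_zero]

end CoefficientRing

/-- Let `p` be a prime, `k` a perfect field of characteristic `p`, and `R` a complete
regular local ring equipped with a local homomorphism `W(k) → R` inducing an
isomorphism on residue fields.  If `x ∈ 𝔪_R^m \ 𝔪_R^(m+1)` for some `m ≥ 1`, then
there exist a `p`-adically complete rank-one valuation ring `V` over `W(k)` with
algebraically closed fraction field, a nonzero nonunit `a ∈ V` with `p ∈ (a)`, and a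
`W(k)`-algebra homomorphism `g : R → V/(a^(m+1))` with `g(𝔪_R) ⊆ (a)` and `g x ≠ 0`. -/
theorem exists_valuation_ring_witness
    (p : ℕ) [Fact p.Prime] (k : Type) [Field k] [CharP k p] [PerfectRing k p]
    (R : Type) [CommRing R] [IsLocalRing R]
    [IsAdicComplete (IsLocalRing.maximalIdeal R) R]
    (hreg : IsRegularLocal R)
    [IsLocalRing (WittVector p k)]
    (ι : WittVector p k →+* R) [IsLocalHom ι]
    (hres : Function.Bijective (IsLocalRing.ResidueField.map ι))
    (m : ℕ) (hm : 1 ≤ m) (x : R)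
    (hx : x ∈ IsLocalRing.maximalIdeal R ^ m)
    (hx' : x ∉ IsLocalRing.maximalIdeal R ^ (m + 1)) :
    Nonempty (ValuationRingWitness p k R ι m x) := by
  have := hreg.1
  obtain ⟨s, hs, hdim⟩ := hreg.2
  let z : s → R := Subtype.val
  have hz : Ideal.span (Set.range z) = maximalIdeal R := by
    rw [Subtype.range_coe_subtype]
    exact hs
  have hdim' : (Fintype.card s : WithBot ℕ∞) = ringKrullDim R := by rwa [Fintype.card_coe]
  have hι (r : R) : ∃ w, r - ι w ∈ maximalIdeal R := by
    obtain ⟨w, hw⟩ := hres.2 (residue R r)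
    obtain ⟨w, rfl⟩ := residue_surjective w
    refine ⟨w, ?_⟩
    rw [← residue_eq_zero_iff, map_sub, ← hw, ResidueField.map_residue, sub_self]
  have hirr := WittVector.irreducible p (k := k)
  have hι' (w) (hw : ι w ∈ maximalIdeal R) : (p : WittVector p k) ∣ w := by
    rw [← Ideal.mem_span_singleton, ← hirr.maximalIdeal_eq]
    exact fun h => hw (h.map ι)
  have hιp : ι p ∈ maximalIdeal R := fun h => hirr.not_isUnit (isUnit_of_map_unit ι _ h)
  obtain ⟨f, hf, hfp⟩ := exists_mem_pow_idealOfVars_sub_eval₂_mem hz hι m 1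
    (y := ι p) (by rwa [pow_one])
  rw [pow_one] at hf
  rw [add_comm] at hfp
  obtain ⟨G, hG, hxG⟩ := exists_isHomogeneous_sub_eval₂_mem hz hι hx
  obtain ⟨e, he⟩ : ∃ e, IsUnit (G.coeff e) := by
    by_contra! H
    obtain ⟨Q, hQ⟩ : MvPolynomial.C (p : WittVector p k) ∣ G :=
      MvPolynomial.C_dvd_iff_dvd_coeff _ _ |>.2 fun e =>
        hι' _ fun h => H e (isUnit_of_map_unit ι _ h)
    have hQ' : G = MvPolynomial.C (p : WittVector p k) * MvPolynomial.homogeneousComponent m Q := by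
      rw [← MvPolynomial.homogeneousComponent_C_mul, ← hQ,
        MvPolynomial.homogeneousComponent_eq_self hG]
    refine hx' ?_
    rw [← sub_add_cancel x (G.eval₂ ι z)]
    refine add_mem hxG ?_
    rw [hQ', MvPolynomial.eval₂_mul, MvPolynomial.eval₂_C, pow_succ']
    refine Ideal.mul_mem_mul hιp (MvPolynomial.eval₂_mem_pow_of_mem_pow_idealOfVars ι
      (fun j => hz ▸ Ideal.subset_span ⟨j, rfl⟩)
      (MvPolynomial.homogeneousComponent_isHomogeneous m Q).mem_pow_idealOfVars)
  obtain ⟨V, _, _, _, φ, hp0, hpu, hcomp, hVdim, hfrac, hV⟩ :=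
    exists_complete_valuationRing_pseudoUniformizer hirr.ne_zero hirr.not_isUnit
  have := infinite_residueField hV
  obtain ⟨c, hc⟩ := exists_isUnit_eval₂ φ he
  let F : Polynomial V := f.eval₂ (Polynomial.C.comp φ) fun j => Polynomial.X * Polynomial.C (c j)
  have hF (b : V) : F.eval b = f.eval₂ φ fun j => b * c j := by
    have := MvPolynomial.eval₂_comp_left (Polynomial.evalRingHom b) (Polynomial.C.comp φ)
      (fun j => Polynomial.X * Polynomial.C (c j)) f
    rw [Polynomial.coe_evalRingHom] at this
    refine this.trans ?_
    congr 1
    · ext; simp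
    · ext; simp only [Function.comp_apply, Polynomial.eval_mul, Polynomial.eval_X, Polynomial.eval_C]
  have hF0 : F.coeff 0 = 0 := by
    rw [Polynomial.coeff_zero_eq_eval_zero, hF]
    simpa using MvPolynomial.eval₂_mem_pow_of_mem_pow_idealOfVars φ (I := ⊥) (n := 1)
      (x := fun j => 0 * c j) (fun j => by simp) (by rwa [pow_one])
  obtain ⟨a, ha0, hau, hap, haF⟩ :=
    Polynomial.exists_dvd_eval_sub_of_splits hV hF0 hp0 hpu (m + 1)
  let q : V →+* V ⧸ Ideal.span {a ^ (m + 1)} := Ideal.Quotient.mk _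
  have hqz (j) : q (a * c j) ∈ Ideal.span {q a} := by
    rw [map_mul]
    exact Ideal.mul_mem_right _ _ (Ideal.mem_span_singleton_self _)
  have hq (P : MvPolynomial s (WittVector p k)) :
      P.eval₂ (q.comp φ) (fun j => q (a * c j)) = q (P.eval₂ φ fun j => a * c j) :=
    (MvPolynomial.eval₂_comp_left q φ _ P).symm
  obtain ⟨g, hg, hg0⟩ := exists_ringHom_eval₂_eq hz hι hdim' hι' hf hfp (q.comp φ)
    (z := fun j => q (a * c j)) (I := Ideal.span {q a}) (by
      rw [Ideal.span_singleton_pow, ← map_pow, Ideal.span_singleton_eq_bot,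
        Ideal.Quotient.eq_zero_iff_mem]
      exact Ideal.mem_span_singleton_self _) hqz (by
      rw [hq, ← hF]
      exact (Ideal.Quotient.mk_eq_mk_iff_sub_mem _ _).2 (Ideal.mem_span_singleton.2 haF))
  rw [map_natCast] at hcomp hap
  refine ⟨{
    V := V
    dim_one := hVdim
    p_adically_complete := hcomp
    frac_alg_closed := hfrac
    φ := φ
    a := a
    a_ne_zero := ha0
    a_not_unit := hau
    p_mem_span_a := Ideal.mem_span_singleton.2 hap
    g := g
    g_compat := RingHom.ext fun w => by simpa using hg (MvPolynomial.C w)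
    g_maximalIdeal := fun y hy => ?_
    g_x_ne_zero := fun h => ?_ }⟩
  · have : maximalIdeal R ≤ (Ideal.span {q a}).comap g := by
      rw [← hz, Ideal.span_le]
      rintro _ ⟨j, rfl⟩
      have := hg (MvPolynomial.X j)
      rw [MvPolynomial.eval₂_X, MvPolynomial.eval₂_X] at this
      rw [SetLike.mem_coe, Ideal.mem_comap, this]
      exact hqz j
    exact this hy
  · have h1 := hg0 _ hxG
    rw [map_sub, h, zero_sub, neg_eq_zero, hg, hq, hG.eval₂_mul_left,
      Ideal.Quotient.eq_zero_iff_mem, Ideal.mem_span_singleton, hc.dvd_mul_right, pow_succ] at h1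
    obtain ⟨b, hb⟩ := h1
    rw [mul_assoc] at hb
    exact hau (IsUnit.of_mul_eq_one b
      (mul_left_cancel₀ (pow_ne_zero m ha0) ((mul_one _).trans hb)).symm)
end
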